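/- Let X be a random vector in ℝ^d with E X = 0 and E[|X|²] = σ²d, and set B := sup_{ξ∈S^{d−1}} E⟨X,ξ⟩². For θ ∈ W_{d,k} let d_BL(X_θ, σZ) denote the conditional bounded-Lipschitz distance sup over f with ‖f‖_∞ ≤ 1 and f 1-Lipschitz of |E[f(X_θ) | θ] − E f(σZ)|, where Z is a standard Gaussian vector in ℝ^k. Then there exist absolute constants C, c > 0 such that for every ε > 0, P_{d,k}[ θ : |d_BL(X_θ, σZ) − E d_BL(X_θ, σZ)| > ε ] ≤ C exp(−c d ε²/B), where the expectation E d_BL(X_θ, σZ) is taken with respect to Haar measure P_{d,k}. -/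

import Mathlib

open MeasureTheory ProbabilityTheory Real
open scoped ENNReal NNReal RealInnerProductSpace

noncomputable section

/-- The Stiefel manifold: `k`-tuples of orthonormal vectors in `ℝ^d`. -/
def Stiefel (d k : ℕ) : Type :=
  {θ : Fin k → EuclideanSpace ℝ (Fin d) // Orthonormal ℝ θ}

instance (d k : ℕ) : MeasurableSpace (Stiefel d k) :=
  Subtype.instMeasurableSpace

/-- The metric `ρ` on the Stiefel manifold. -/
def stiefelDist {d k : ℕ} (θ θ' : Stiefel d k) : ℝ :=
  Real.sqrt (∑ j : Fin k, ‖θ.1 j - θ'.1 j‖ ^ 2)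

/-- The projection `x ↦ (⟨x,θ₁⟩, …, ⟨x,θ_k⟩)` onto the span of `θ`. -/
def stiefelProj {d k : ℕ} (θ : Stiefel d k) (x : EuclideanSpace ℝ (Fin d)) :
    EuclideanSpace ℝ (Fin k) :=
  (EuclideanSpace.equiv (Fin k) ℝ).symm fun i => ⟪θ.1 i, x⟫

/-- Rotation of a Stiefel frame by a linear isometry of `ℝ^d`. -/
def stiefelRotate {d k : ℕ}
    (U : EuclideanSpace ℝ (Fin d) ≃ₗᵢ[ℝ] EuclideanSpace ℝ (Fin d))
    (θ : Stiefel d k) : Stiefel d k :=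
  ⟨fun i => U (θ.1 i), θ.2.comp_linearIsometryEquiv U⟩

/-- A probability measure on the Stiefel manifold is Haar if it is invariant
under every rotation of `ℝ^d`. -/
def IsHaarStiefel {d k : ℕ} (μ : Measure (Stiefel d k)) : Prop :=
  IsProbabilityMeasure μ ∧
    ∀ U : EuclideanSpace ℝ (Fin d) ≃ₗᵢ[ℝ] EuclideanSpace ℝ (Fin d),
      μ.map (stiefelRotate U) = μ

/-- The standard Gaussian measure on `ℝ^k`. -/
def stdGaussian (k : ℕ) : Measure (EuclideanSpace ℝ (Fin k)) :=
  (Measure.pi fun _ : Fin k => gaussianReal 0 1).map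
    (EuclideanSpace.equiv (Fin k) ℝ).symm

/-- The bounded-Lipschitz distance between two measures on `ℝ^k`: the supremum of
`|∫ f dμ - ∫ f dν|` over `f` with `‖f‖_∞ ≤ 1` which are `1`-Lipschitz. -/
def dBL {k : ℕ} (μ ν : Measure (EuclideanSpace ℝ (Fin k))) : ℝ :=
  ⨆ f : {f : EuclideanSpace ℝ (Fin k) → ℝ // (∀ x, |f x| ≤ 1) ∧ LipschitzWith 1 f},
    |∫ x, f.1 x ∂μ - ∫ x, f.1 x ∂ν|


abbrev MPoly (d k : ℕ) := MvPolynomial (Fin d × Fin k) ℝ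

/-- The derivation on polynomials in the matrix entries generated by the linear field `x ↦ a x`. -/
def lieD {d k : ℕ} (a : Matrix (Fin d) (Fin d) ℝ) : Derivation ℝ (MPoly d k) (MPoly d k) :=
  MvPolynomial.mkDerivation ℝ (fun x => ∑ j, a x.1 j • (MvPolynomial.X (j, x.2) : MPoly d k))

lemma lieD_X {d k : ℕ} (a : Matrix (Fin d) (Fin d) ℝ) (x : Fin d × Fin k) :
    lieD a (MvPolynomial.X x : MPoly d k) = ∑ j, a x.1 j • (MvPolynomial.X (j, x.2) : MPoly d k) := by
  simp [lieD, MvPolynomial.mkDerivation_X]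

lemma lieD_add {d k : ℕ} (a b : Matrix (Fin d) (Fin d) ℝ) :
    (lieD (a + b) : Derivation ℝ (MPoly d k) (MPoly d k)) = lieD a + lieD b := by
  apply MvPolynomial.derivation_ext
  intro x
  simp [lieD_X, add_smul, Finset.sum_add_distrib]

lemma lieD_smul {d k : ℕ} (r : ℝ) (a : Matrix (Fin d) (Fin d) ℝ) :
    (lieD (r • a) : Derivation ℝ (MPoly d k) (MPoly d k)) = r • lieD a := by
  apply MvPolynomial.derivation_ext
  intro x
  simp [lieD_X, mul_smul, Finset.smul_sum]

/-- `lieD` as a linear map. -/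
def lieL (d k : ℕ) : Matrix (Fin d) (Fin d) ℝ →ₗ[ℝ] Derivation ℝ (MPoly d k) (MPoly d k) where
  toFun := lieD
  map_add' := lieD_add
  map_smul' := lieD_smul

lemma lieD_comm {d k : ℕ} (a b : Matrix (Fin d) (Fin d) ℝ) (p : MPoly d k) :
    lieD a (lieD b p) - lieD b (lieD a p) = lieD (b * a - a * b) p := by
  have : ⁅(lieD a : Derivation ℝ (MPoly d k) (MPoly d k)), lieD (k := k) b⁆ = lieD (b * a - a * b) := by
    apply MvPolynomial.derivation_ext
    intro x
    rw [Derivation.commutator_apply]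
    simp only [lieD_X, map_sum, Derivation.map_smul, Finset.smul_sum, smul_smul,
      Matrix.sub_apply, Matrix.mul_apply, sub_smul, Finset.sum_sub_distrib, Finset.sum_smul]
    rw [Finset.sum_comm]
    congr 1
    rw [Finset.sum_comm]
  rw [← this, Derivation.commutator_apply]

/-- The basic skew matrices. -/
def skewE {d : ℕ} (i j : Fin d) : Matrix (Fin d) (Fin d) ℝ :=
  Matrix.single i j 1 - Matrix.single j i 1

lemma skewE_transpose {d : ℕ} (i j : Fin d) : (skewE i j).transpose = - skewE i j := by
  simp [skewE]

lemma skewE_self {d : ℕ} (i : Fin d) : skewE i i = 0 := by simp [skewE]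

lemma skewE_swap {d : ℕ} (i j : Fin d) : skewE j i = - skewE i j := by simp [skewE]

lemma skew_bracket {d : ℕ} (b : Matrix (Fin d) (Fin d) ℝ) (hb : b.transpose = -b) (i j : Fin d) :
    b * skewE i j - skewE i j * b = ∑ l, (b l i • skewE l j + b l j • skewE i l) := by
  have hb' : ∀ x y, b x y = - b y x := fun x y => by
    have := congrFun (congrFun hb y) x
    simpa using this
  ext x y
  simp only [skewE, Matrix.mul_sub, Matrix.sub_mul, Matrix.sub_apply, Matrix.sum_apply,
    Matrix.add_apply, Matrix.smul_apply, Matrix.mul_apply, Matrix.single_apply, smul_eq_mul]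
  simp only [mul_sub, Finset.sum_add_distrib, Finset.sum_sub_distrib, mul_ite, ite_mul, mul_one,
    mul_zero, one_mul, zero_mul, ite_and, Finset.sum_ite_eq, Finset.sum_ite_eq', Finset.mem_univ, if_true]
  have h1 := hb' i y
  have h2 := hb' j y
  have h3 := hb' i x
  have h4 := hb' j x
  by_cases c1 : j = y <;> by_cases c2 : i = x <;> by_cases c3 : i = y <;> by_cases c4 : j = x <;>
    simp [c1, c2, c3, c4] <;> grind

lemma skew_expand {d : ℕ} (b : Matrix (Fin d) (Fin d) ℝ) (hb : b.transpose = -b) :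
    b = ∑ i, ∑ j, (b i j / 2) • skewE i j := by
  have hb' : ∀ x y, b x y = - b y x := fun x y => by
    have := congrFun (congrFun hb y) x
    simpa using this
  ext x y
  simp only [skewE, Matrix.sum_apply, Matrix.smul_apply, Matrix.sub_apply, Matrix.single_apply,
    smul_eq_mul, mul_sub, Finset.sum_sub_distrib, mul_ite, mul_one, mul_zero, ite_and,
    Finset.sum_ite_eq, Finset.sum_ite_eq', Finset.mem_univ, if_true]
  simp
  have := hb' x y
  linarith

/-- The Casimir operator. -/
def casimir {d k : ℕ} : MPoly d k →ₗ[ℝ] MPoly d k :=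
  ∑ i, ∑ j, ((lieD (skewE i j)).toLinearMap ∘ₗ (lieD (skewE i j)).toLinearMap)

lemma casimir_apply {d k : ℕ} (p : MPoly d k) :
    casimir p = ∑ i, ∑ j, lieD (skewE i j) (lieD (skewE i j) p) := by
  simp [casimir, LinearMap.sum_apply]

lemma lieD_lin {d k : ℕ} {ι : Type*} (s : Finset ι) (c : ι → ℝ) (a : ι → Matrix (Fin d) (Fin d) ℝ)
    (p : MPoly d k) : lieD (∑ i ∈ s, c i • a i) p = ∑ i ∈ s, c i • lieD (a i) p := by
  have : lieL d k (∑ i ∈ s, c i • a i) = ∑ i ∈ s, c i • lieL d k (a i) := by simp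
  have h2 := congrArg (fun D : Derivation ℝ (MPoly d k) (MPoly d k) => D p) this
  have h3 : ∀ a, lieL d k a = lieD a := fun _ => rfl
  simp only [h3] at h2
  rw [h2]
  rw [← Derivation.coeFnAddMonoidHom_apply, map_sum]
  simp

lemma lieD_bracket_skewE {d k : ℕ} (b : Matrix (Fin d) (Fin d) ℝ) (hb : b.transpose = -b)
    (i j : Fin d) (p : MPoly d k) :
    lieD (skewE i j) (lieD b p) = lieD b (lieD (skewE i j) p) +
      ∑ l, (b l i • lieD (skewE l j) p + b l j • lieD (skewE i l) p) := by
  have h := lieD_comm (k := k) (skewE i j) b p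
  rw [skew_bracket b hb] at h
  rw [Finset.sum_add_distrib, lieD_add, Derivation.add_apply, lieD_lin, lieD_lin] at h
  rw [Finset.sum_add_distrib, ← h]
  abel

lemma anti_sum_zero {d : ℕ} {M : Type*} [AddCommGroup M] [Module ℝ M] (b : Matrix (Fin d) (Fin d) ℝ)
    (hb : b.transpose = -b) (T : Fin d → Fin d → M) (hT : ∀ i l, T i l = T l i) :
    ∑ i, ∑ l, b l i • T i l = 0 := by
  have hb' : ∀ x y, b x y = - b y x := fun x y => by
    have := congrFun (congrFun hb y) x
    simpa using this
  have h : ∑ i, ∑ l, b l i • T i l = - ∑ i, ∑ l, b l i • T i l := by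
    conv_lhs => rw [Finset.sum_comm]
    simp only [← Finset.sum_neg_distrib]
    refine Finset.sum_congr rfl fun i _ => Finset.sum_congr rfl fun l _ => ?_
    rw [hb' i l, hT l i, neg_smul]
  have h2 : (2:ℝ) • ∑ i, ∑ l, b l i • T i l = 0 := by
    rw [two_smul]; nth_rewrite 1 [h]; simp
  simpa using h2

lemma casimir_comm {d k : ℕ} (b : Matrix (Fin d) (Fin d) ℝ) (hb : b.transpose = -b)
    (p : MPoly d k) : casimir (lieD b p) = lieD b (casimir p) := by
  simp only [casimir_apply, map_sum]
  have key : ∀ i j, lieD (skewE i j) (lieD (skewE i j) (lieD b p)) =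
      lieD b (lieD (skewE i j) (lieD (skewE i j) p)) +
      ((∑ l, b l i • (lieD (skewE l j) (lieD (skewE i j) p) + lieD (skewE i j) (lieD (skewE l j) p)))
      + ∑ l, b l j • (lieD (skewE i l) (lieD (skewE i j) p) + lieD (skewE i j) (lieD (skewE i l) p))) := by
    intro i j
    rw [lieD_bracket_skewE b hb i j p, map_add, lieD_bracket_skewE b hb i j]
    simp only [map_sum, map_add, Derivation.map_smul, smul_add, Finset.sum_add_distrib]
    abel
  simp only [key, Finset.sum_add_distrib]
  have z1 : ∑ i, ∑ j, ∑ l, b l i • (lieD (skewE l j) (lieD (skewE i j) p) + lieD (skewE i j) (lieD (skewE l j) p)) = 0 := by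
    rw [Finset.sum_comm]
    refine Finset.sum_eq_zero fun j _ => anti_sum_zero b hb _ fun i l => add_comm _ _
  have z2 : ∑ i, ∑ j, ∑ l, b l j • (lieD (skewE i l) (lieD (skewE i j) p) + lieD (skewE i j) (lieD (skewE i l) p)) = 0 := by
    refine Finset.sum_eq_zero fun j _ => anti_sum_zero b hb _ fun i l => add_comm _ _
  simp only [smul_add, Finset.sum_add_distrib] at z1 z2 ⊢
  rw [z1, z2]
  simp

lemma skewE_triple {d k : ℕ} (i j l : Fin d) (hij : j ≠ i) (hjl : j ≠ l) (p : MPoly d k) :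
    lieD (skewE i l) p = lieD (skewE j l) (lieD (skewE i j) p)
      - lieD (skewE i j) (lieD (skewE j l) p) := by
  by_cases hil : i = l
  · subst hil
    have h := lieD_comm (k := k) (skewE j i) (skewE i j) p
    rw [h, skewE_self, skewE_swap i j]
    simp
  rw [lieD_comm]
  congr 2
  simp [skewE, Matrix.mul_sub, Matrix.sub_mul, hij, hjl, hil, hij.symm, hjl.symm, Ne.symm hil]


abbrev EE (d : ℕ) := EuclideanSpace ℝ (Fin d)

instance instMetricStiefel (d k : ℕ) : MetricSpace (Stiefel d k) :=
  inferInstanceAs (MetricSpace {θ : Fin k → EuclideanSpace ℝ (Fin d) // Orthonormal ℝ θ})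

instance instBorelStiefel (d k : ℕ) : BorelSpace (Stiefel d k) :=
  inferInstanceAs (BorelSpace {θ : Fin k → EuclideanSpace ℝ (Fin d) // Orthonormal ℝ θ})

instance instCompactStiefel (d k : ℕ) : CompactSpace (Stiefel d k) := by
  have : IsCompact {θ : Fin k → EuclideanSpace ℝ (Fin d) | Orthonormal ℝ θ} := by
    refine IsCompact.of_isClosed_subset (isCompact_closedBall (0 : Fin k → EE d) 1) ?_ ?_
    · simp only [orthonormal_iff_ite, Set.ofPred_forall]
      refine isClosed_iInter fun i => isClosed_iInter fun j => isClosed_eq (by fun_prop) (by fun_prop)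
    · intro θ hθ
      simp only [Metric.mem_closedBall, dist_zero_right]
      rw [pi_norm_le_iff_of_nonneg zero_le_one]
      intro i
      exact (hθ.1 i).le
  exact isCompact_iff_compactSpace.1 this

/-- Coordinates of a frame. -/
def cS {d k : ℕ} (θ : Stiefel d k) : Fin d × Fin k → ℝ := fun x => θ.1 x.2 x.1

lemma continuous_cS {d k : ℕ} : Continuous (cS : Stiefel d k → _) := by
  refine continuous_pi fun x => ?_
  have h1 : Continuous fun θ : Stiefel d k => θ.1 := continuous_subtype_val
  have h2 : Continuous fun θ : Stiefel d k => θ.1 x.2 := (continuous_apply x.2).comp h1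
  exact (EuclideanSpace.proj (𝕜 := ℝ) x.1).continuous.comp h2

/-- Evaluation of a polynomial on a frame. -/
def ev {d k : ℕ} (p : MPoly d k) (θ : Stiefel d k) : ℝ := MvPolynomial.eval (cS θ) p

lemma continuous_ev {d k : ℕ} (p : MPoly d k) : Continuous (ev p) :=
  (MvPolynomial.continuous_eval p).comp continuous_cS

lemma continuous_rotate {d k : ℕ} (U : EE d ≃ₗᵢ[ℝ] EE d) :
    Continuous (stiefelRotate U : Stiefel d k → Stiefel d k) := by
  refine Continuous.subtype_mk ?_ _
  refine continuous_pi fun i => U.continuous.comp ?_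
  exact (continuous_apply i).comp continuous_subtype_val

lemma rotate_rotate {d k : ℕ} (U V : EE d ≃ₗᵢ[ℝ] EE d) (θ : Stiefel d k) :
    stiefelRotate U (stiefelRotate V θ) = stiefelRotate (U * V) θ := rfl

lemma eval_curve {d k : ℕ} (y : ℝ → Fin d × Fin k → ℝ) (a : Matrix (Fin d) (Fin d) ℝ) (t : ℝ)
    (hy : ∀ x, HasDerivAt (fun s => y s x) (∑ j, a x.1 j * y t (j, x.2)) t) (p : MPoly d k) :
    HasDerivAt (fun s => MvPolynomial.eval (y s) p) (MvPolynomial.eval (y t) (lieD a p)) t := by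
  induction p using MvPolynomial.induction_on with
  | C r => simpa using hasDerivAt_const t r
  | add p q hp hq => simpa using hp.fun_add hq
  | mul_X p x hp =>
    have := hp.fun_mul (hy x)
    simp only [map_mul, MvPolynomial.eval_X, Derivation.leibniz, lieD_X, map_add, smul_eq_mul,
      map_sum, MvPolynomial.smul_eval]
    refine this.congr_deriv ?_
    rw [add_comm, mul_comm (y t x)]

/-- CLM of a matrix. -/
def mC {d : ℕ} (a : Matrix (Fin d) (Fin d) ℝ) : EE d →L[ℝ] EE d :=
  Matrix.toEuclideanCLM (n := Fin d) (𝕜 := ℝ) a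

lemma mC_apply {d : ℕ} (a : Matrix (Fin d) (Fin d) ℝ) (x : EE d) (i : Fin d) :
    mC a x i = ∑ j, a i j * x j := rfl

lemma mC_skew {d : ℕ} (a : Matrix (Fin d) (Fin d) ℝ) (ha : a.transpose = -a) (t : ℝ) :
    t • mC a ∈ skewAdjoint (EE d →L[ℝ] EE d) := by
  rw [skewAdjoint.mem_iff, star_smul, mC, ← map_star, Matrix.star_eq_conjTranspose,
    Matrix.conjTranspose_eq_transpose_of_trivial, ha]
  simp

/-- The one-parameter rotation group generated by `a`. -/
def flow {d : ℕ} (a : Matrix (Fin d) (Fin d) ℝ) (ha : a.transpose = -a) (t : ℝ) :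
    EE d ≃ₗᵢ[ℝ] EE d :=
  Unitary.linearIsometryEquiv ⟨NormedSpace.exp (t • mC a),
    letI : NormedAlgebra ℚ (EE d →L[ℝ] EE d) := NormedAlgebra.restrictScalars ℚ ℝ _
    NormedSpace.exp_mem_unitary_of_mem_skewAdjoint (mC_skew a ha t)⟩

lemma flow_apply {d : ℕ} (a : Matrix (Fin d) (Fin d) ℝ) (ha : a.transpose = -a) (t : ℝ) (x : EE d) :
    flow a ha t x = NormedSpace.exp (t • mC a) x := rfl

lemma flow_zero {d : ℕ} (a : Matrix (Fin d) (Fin d) ℝ) (ha : a.transpose = -a) (x : EE d) :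
    flow a ha 0 x = x := by
  rw [flow_apply, zero_smul ℝ (mC a), NormedSpace.exp_zero]
  rfl

lemma flow_deriv {d : ℕ} (a : Matrix (Fin d) (Fin d) ℝ) (ha : a.transpose = -a) (t : ℝ) (x : EE d) :
    HasDerivAt (fun s => flow a ha s x) (mC a (flow a ha t x)) t := by
  have h := hasDerivAt_exp_smul_const' (𝕂 := ℝ) (mC a) t
  have := h.clm_apply (hasDerivAt_const t x)
  simpa [flow_apply] using this

lemma flow_deriv' {d : ℕ} (a : Matrix (Fin d) (Fin d) ℝ) (ha : a.transpose = -a) (t : ℝ) (x : EE d) :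
    HasDerivAt (fun s => flow a ha s x) (flow a ha t (mC a x)) t := by
  have h := hasDerivAt_exp_smul_const (𝕂 := ℝ) (mC a) t
  have := h.clm_apply (hasDerivAt_const t x)
  simpa [flow_apply] using this

lemma rotate_flow_zero {d k : ℕ} (a : Matrix (Fin d) (Fin d) ℝ) (ha : a.transpose = -a)
    (θ : Stiefel d k) : stiefelRotate (flow a ha 0) θ = θ := by
  apply Subtype.ext
  funext i
  exact flow_zero a ha _

lemma ev_flow_deriv {d k : ℕ} (a : Matrix (Fin d) (Fin d) ℝ) (ha : a.transpose = -a) (t : ℝ)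
    (p : MPoly d k) (θ : Stiefel d k) :
    HasDerivAt (fun s => ev p (stiefelRotate (flow a ha s) θ))
      (ev (lieD a p) (stiefelRotate (flow a ha t) θ)) t := by
  apply eval_curve
  rintro ⟨i, m⟩
  have := flow_deriv a ha t (θ.1 m)
  exact (EuclideanSpace.proj (𝕜 := ℝ) i).hasFDerivAt.comp_hasDerivAt t this

lemma ev_lieD_eq_deriv {d k : ℕ} (a : Matrix (Fin d) (Fin d) ℝ) (ha : a.transpose = -a)
    (p : MPoly d k) (θ : Stiefel d k) :
    HasDerivAt (fun s => ev p (stiefelRotate (flow a ha s) θ)) (ev (lieD a p) θ) 0 := by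
  have := ev_flow_deriv a ha 0 p θ
  rwa [rotate_flow_zero] at this

lemma ev_lieD_congr {d k : ℕ} (a : Matrix (Fin d) (Fin d) ℝ) (ha : a.transpose = -a)
    (p q : MPoly d k) (h : ∀ θ, ev p θ = ev q θ) (θ : Stiefel d k) :
    ev (lieD a p) θ = ev (lieD a q) θ := by
  have h1 := ev_lieD_eq_deriv a ha p θ
  simp only [h] at h1
  exact h1.unique (ev_lieD_eq_deriv a ha q θ)

/-- `‖(e^{ta} - 1) x‖ ≤ |t| ‖a x‖`. -/
lemma flow_dist {d : ℕ} (a : Matrix (Fin d) (Fin d) ℝ) (ha : a.transpose = -a) (t : ℝ) (x : EE d) :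
    ‖flow a ha t x - x‖ ≤ ‖mC a x‖ * |t| := by
  have := Convex.norm_image_sub_le_of_norm_hasDerivWithin_le (f := fun s => flow a ha s x)
    (f' := fun s => flow a ha s (mC a x)) (s := Set.univ) (x := 0) (y := t) (C := ‖mC a x‖)
    (fun s _ => (flow_deriv' a ha s x).hasDerivWithinAt)
    (fun s _ => by simp) convex_univ (Set.mem_univ _) (Set.mem_univ _)
  simpa [flow_zero] using this

lemma frame_HS {d k : ℕ} (a : Matrix (Fin d) (Fin d) ℝ) (η : Stiefel d k) :
    ∑ m, ‖mC a (η.1 m)‖ ^ 2 ≤ ∑ i, ∑ j, a i j ^ 2 := by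
  have h1 : ∀ m, ‖mC a (η.1 m)‖ ^ 2 = ∑ i, ‖⟪η.1 m, WithLp.toLp 2 (a i)⟫‖ ^ 2 := by
    intro m
    rw [EuclideanSpace.norm_sq_eq]
    refine Finset.sum_congr rfl fun i _ => ?_
    rw [mC_apply]
    simp [PiLp.inner_apply]
  simp only [h1]
  rw [Finset.sum_comm]
  refine Finset.sum_le_sum fun i _ => ?_
  have := η.2.sum_inner_products_le (WithLp.toLp 2 (a i)) (s := Finset.univ)
  refine this.trans (le_of_eq ?_)
  rw [EuclideanSpace.norm_sq_eq]
  simp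

lemma flow_stiefelDist {d k : ℕ} (a : Matrix (Fin d) (Fin d) ℝ) (ha : a.transpose = -a) (t : ℝ)
    (η : Stiefel d k) :
    stiefelDist (stiefelRotate (flow a ha t) η) η ≤ √(∑ i, ∑ j, a i j ^ 2) * |t| := by
  unfold stiefelDist
  rw [← Real.sqrt_sq_eq_abs, ← Real.sqrt_mul (by positivity)]
  apply Real.sqrt_le_sqrt
  calc ∑ m, ‖(stiefelRotate (flow a ha t) η).1 m - η.1 m‖ ^ 2
      ≤ ∑ m, ‖mC a (η.1 m)‖ ^ 2 * t ^ 2 := by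
        refine Finset.sum_le_sum fun m _ => ?_
        have := flow_dist a ha t (η.1 m)
        rw [← sq_abs t, ← mul_pow]
        gcongr
        exact this
    _ ≤ _ := by
        rw [← Finset.sum_mul]
        gcongr
        exact frame_HS a η

/-- transitivity -/
lemma exists_rotate {d k : ℕ} (θ θ' : Stiefel d k) :
    ∃ U : EE d ≃ₗᵢ[ℝ] EE d, stiefelRotate U θ = θ' := by
  have ext : ∀ η : Stiefel d k, ∀ hkd : k ≤ d, ∃ b : OrthonormalBasis (Fin d) ℝ (EE d),
      ∀ m : Fin k, b (Fin.castLE hkd m) = η.1 m := by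
    intro η hkd
    let v : Fin d → EE d := fun i => if h : i.1 < k then η.1 ⟨i.1, h⟩ else 0
    obtain ⟨b, hb⟩ := Orthonormal.exists_orthonormalBasis_extension_of_card_eq (𝕜 := ℝ)
      (E := EE d) (ι := Fin d) (by simp) (v := v) (s := {i | i.1 < k}) (by
        have : (Set.domRestrict {i : Fin d | i.1 < k} v) = η.1 ∘ (fun i => ⟨i.1.1, i.2⟩) := by
          funext i
          have := i.2
          simp only [Set.mem_ofPred_eq] at this
          simp [v, this, Set.domRestrict]
        rw [this]
        refine η.2.comp _ ?_
        intro i j hij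
        simp only [Fin.mk.injEq] at hij
        exact Subtype.ext (Fin.ext hij))
    refine ⟨b, fun m => ?_⟩
    rw [hb _ (by simp)]
    simp [v]
  have hkd : k ≤ d := by
    have := θ.2.linearIndependent.fintype_card_le_finrank
    simpa using this
  obtain ⟨b, hb⟩ := ext θ hkd
  obtain ⟨b', hb'⟩ := ext θ' hkd
  refine ⟨b.equiv b' (Equiv.refl _), ?_⟩
  apply Subtype.ext
  funext m
  change (b.equiv b' (Equiv.refl _)) (θ.1 m) = θ'.1 m
  rw [← hb, ← hb']
  simp


/-- sign vector -/
def sgn {k : ℕ} (m0 m : Fin k) : ℝ := if m = m0 then -1 else 1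

lemma sgn_sq {k : ℕ} (m0 m : Fin k) : sgn m0 m * sgn m0 m = 1 := by
  unfold sgn; split_ifs <;> norm_num

/-- Flip the sign of the frame vector number `m0`. -/
def flipS {d k : ℕ} (m0 : Fin k) (θ : Stiefel d k) : Stiefel d k :=
  ⟨fun m => sgn m0 m • θ.1 m, by
    have h := θ.2
    rw [orthonormal_iff_ite] at h ⊢
    intro i j
    rw [real_inner_smul_left, real_inner_smul_right, h i j]
    split_ifs with hij
    · subst hij; rw [mul_one, sgn_sq]
    · simp⟩

lemma continuous_flipS {d k : ℕ} (m0 : Fin k) :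
    Continuous (flipS m0 : Stiefel d k → Stiefel d k) := by
  refine Continuous.subtype_mk ?_ _
  refine continuous_pi fun i => Continuous.fun_const_smul ?_ _
  exact (continuous_apply i).comp continuous_subtype_val

lemma flip_rotate {d k : ℕ} (m0 : Fin k) (U : EE d ≃ₗᵢ[ℝ] EE d) (θ : Stiefel d k) :
    flipS m0 (stiefelRotate U θ) = stiefelRotate U (flipS m0 θ) := by
  apply Subtype.ext
  funext m
  simp [flipS, stiefelRotate]

/-- reflection orthogonal to `u` -/
def hRefl {d : ℕ} (u : EE d) : EE d ≃ₗᵢ[ℝ] EE d := (ℝ ∙ u)ᗮ.reflection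

lemma hRefl_apply {d : ℕ} (u x : EE d) :
    hRefl u x = x - (2 * (⟪u, x⟫ / ‖u‖ ^ 2)) • u := by
  rw [hRefl, Submodule.reflection_orthogonal_apply, Submodule.reflection_singleton_apply]
  simp [two_smul, two_mul, add_smul]

lemma hRefl_flip {d k : ℕ} (m0 : Fin k) (θ : Stiefel d k) :
    stiefelRotate (hRefl (θ.1 m0)) θ = flipS m0 θ := by
  apply Subtype.ext
  funext m
  have h := θ.2
  have h1 := (orthonormal_iff_ite.1 h) m0 m
  have h2 := h.1 m0
  change hRefl (θ.1 m0) (θ.1 m) = sgn m0 m • θ.1 m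
  rw [hRefl_apply, h1, h2]
  unfold sgn
  by_cases hm : m0 = m
  · subst hm; simp; module
  · simp [hm, Ne.symm hm]

lemma hRefl_curve {d : ℕ} (u z x : EE d) (t : ℝ) (hw : u + t • z ≠ 0) :
    HasDerivAt (fun s : ℝ => hRefl (u + s • z) x)
      (mC ((2 / ‖u + t • z‖ ^ 2) • (Matrix.vecMulVec z (u + t • z) - Matrix.vecMulVec (u + t • z) z))
        (hRefl (u + t • z) x)) t := by
  have hN : ‖u + t • z‖ ^ 2 ≠ 0 := by simpa using hw
  have e : ∀ y, mC ((2 / ‖u + t • z‖ ^ 2) •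
      (Matrix.vecMulVec z (u + t • z) - Matrix.vecMulVec (u + t • z) z)) y =
      (2 / ‖u + t • z‖ ^ 2) • (⟪u + t • z, y⟫ • z - ⟪z, y⟫ • (u + t • z)) := by
    intro y
    ext i
    rw [mC_apply]
    simp only [Matrix.smul_apply, Matrix.sub_apply, Matrix.vecMulVec_apply, PiLp.smul_apply,
      PiLp.sub_apply, PiLp.inner_apply, smul_eq_mul, Finset.sum_mul, mul_sub, Finset.mul_sum,
      sub_mul, ← Finset.sum_sub_distrib]
    refine Finset.sum_congr rfl fun j _ => ?_
    simp
    ring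
  rw [e]
  have hc : HasDerivAt (fun s : ℝ => u + s • z) z t := by
    simpa using ((hasDerivAt_id t).smul_const z).const_add u
  have h1 : HasDerivAt (fun s : ℝ => ⟪u + s • z, x⟫) ⟪z, x⟫ t := by
    simpa using hc.inner ℝ (hasDerivAt_const t x)
  have h2 : HasDerivAt (fun s : ℝ => ‖u + s • z‖ ^ 2) (2 * ⟪u + t • z, z⟫) t := hc.norm_sq
  have h3 := ((h1.fun_div h2 hN).const_mul 2).fun_smul hc
  have h4 := h3.const_sub x
  simp only [hRefl_apply]
  refine h4.congr_deriv ?_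
  have hin : ⟪u + t • z, u + t • z⟫ = ‖u + t • z‖ ^ 2 := real_inner_self_eq_norm_sq _
  rw [inner_sub_right, inner_sub_right, real_inner_smul_right, real_inner_smul_right, hin,
    real_inner_comm z (u + t • z)]
  generalize ‖u + t • z‖ ^ 2 = N at *
  generalize u + t • z = w at *
  match_scalars <;> field_simp <;> ring

lemma hRefl_const {d k : ℕ} (p : MPoly d k)
    (hgrad : ∀ a : Matrix (Fin d) (Fin d) ℝ, a.transpose = -a → ∀ θ : Stiefel d k, ev (lieD a p) θ = 0)
    (θ : Stiefel d k) (u v : EE d) (hu : ‖u‖ = 1) (hv : ‖v‖ = 1) :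
    ev p (stiefelRotate (hRefl u) θ) = ev p (stiefelRotate (hRefl v) θ) := by
  by_cases huv : v = -u
  · subst huv
    congr 2
    ext x
    simp [hRefl_apply]
    ring
  have hne : ∀ t : ℝ, t ∈ Set.Icc (0:ℝ) 1 → u + t • (v - u) ≠ 0 := by
    intro t ht h0
    have h1 : t • v = -((1 - t) • u) := by
      rw [← sub_eq_zero, ← h0]; module
    have h2 : t = 1 - t := by
      have := congrArg norm h1
      rw [norm_neg, norm_smul, norm_smul, hu, hv, Real.norm_of_nonneg ht.1,
        Real.norm_of_nonneg (by linarith [ht.2])] at this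
      linarith
    have h3 : t = 1 / 2 := by linarith
    apply huv
    subst h3
    have : (1/2 : ℝ) • v = (1/2 : ℝ) • (-u) := by rw [h1]; norm_num
    exact smul_right_injective _ (by norm_num : (1/2:ℝ) ≠ 0) this
  have hd : ∀ t ∈ Set.Icc (0:ℝ) 1,
      HasDerivAt (fun s => ev p (stiefelRotate (hRefl (u + s • (v - u))) θ)) 0 t := by
    intro t ht
    set a : Matrix (Fin d) (Fin d) ℝ := (2 / ‖u + t • (v - u)‖ ^ 2) •
      (Matrix.vecMulVec (v - u) (u + t • (v - u)) - Matrix.vecMulVec (u + t • (v - u)) (v - u)) with ha_def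
    have ha : a.transpose = -a := by
      rw [ha_def]
      simp [Matrix.transpose_vecMulVec, ← smul_neg]
    have h := eval_curve (fun s => cS (stiefelRotate (hRefl (u + s • (v - u))) θ)) a t (by
      rintro ⟨i, m⟩
      exact (EuclideanSpace.proj (𝕜 := ℝ) i).hasFDerivAt.comp_hasDerivAt t
        (hRefl_curve u (v - u) (θ.1 m) t (hne t ht))) p
    have h0 := hgrad a ha (stiefelRotate (hRefl (u + t • (v - u))) θ)
    unfold ev at h0
    rw [h0] at h
    exact h
  have := constant_of_has_deriv_right_zero (a := (0:ℝ)) (b := 1)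
    (f := fun s => ev p (stiefelRotate (hRefl (u + s • (v - u))) θ))
    (fun t ht => (hd t ht).continuousAt.continuousWithinAt)
    (fun t ht => (hd t ⟨ht.1, ht.2.le⟩).hasDerivWithinAt) 1 (by simp)
  simp only [one_smul, add_sub_cancel, zero_smul, add_zero] at this
  exact this.symm

lemma ev_const {d k : ℕ} (m0 : Fin k) (p : MPoly d k)
    (hflip : ∀ θ : Stiefel d k, ev p (flipS m0 θ) = ev p θ)
    (hgrad : ∀ a : Matrix (Fin d) (Fin d) ℝ, a.transpose = -a → ∀ θ : Stiefel d k, ev (lieD a p) θ = 0)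
    (θ θ' : Stiefel d k) : ev p θ = ev p θ' := by
  have h1 : ∀ (u : EE d) (θ : Stiefel d k), ev p (stiefelRotate (hRefl u) θ) = ev p θ := by
    intro u θ
    by_cases hu : u = 0
    · subst hu
      congr 1
      apply Subtype.ext
      funext m
      simp [stiefelRotate, hRefl_apply]
    have e : hRefl u = hRefl (‖u‖⁻¹ • u) := by
      have hN : ‖u‖ ≠ 0 := by simpa using hu
      ext1 x
      rw [hRefl_apply, hRefl_apply, real_inner_smul_left, norm_smul, norm_inv, norm_norm,
        inv_mul_cancel₀ hN, smul_smul]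
      congr 2
      field_simp
    rw [e, hRefl_const p hgrad θ _ (θ.1 m0) (by simp [norm_smul, hu]) (θ.2.1 m0), hRefl_flip, hflip]
  have h2 : ∀ (l : List (EE d)) (θ : Stiefel d k),
      ev p (stiefelRotate (l.map hRefl).prod θ) = ev p θ := by
    intro l
    induction l with
    | nil => intro θ; rfl
    | cons u l ih =>
      intro θ
      rw [List.map_cons, List.prod_cons, ← rotate_rotate, h1, ih]
  obtain ⟨U, rfl⟩ := exists_rotate θ θ'
  obtain ⟨l, -, hl⟩ := U.reflections_generate_dim
  rw [hl]
  exact (h2 l θ).symm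


lemma integrable_of_cont {d k : ℕ} {μ : Measure (Stiefel d k)} [IsProbabilityMeasure μ]
    {f : Stiefel d k → ℝ} (hf : Continuous f) : Integrable f μ :=
  hf.integrable_of_hasCompactSupport (HasCompactSupport.of_compactSpace f)

lemma exists_bound_cont {d k : ℕ} {f : Stiefel d k → ℝ} (hf : Continuous f) :
    ∃ C, ∀ θ, ‖f θ‖ ≤ C := by
  obtain ⟨C, hC⟩ := isCompact_univ.exists_bound_of_continuousOn (f := f) hf.continuousOn
  exact ⟨C, fun θ => hC θ (Set.mem_univ _)⟩

lemma integral_rotate {d k : ℕ} {μ : Measure (Stiefel d k)} (hμ : IsHaarStiefel μ)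
    (U : EE d ≃ₗᵢ[ℝ] EE d) {f : Stiefel d k → ℝ} (hf : Continuous f) :
    ∫ θ, f (stiefelRotate U θ) ∂μ = ∫ θ, f θ ∂μ := by
  conv_rhs => rw [← hμ.2 U]
  rw [integral_map (continuous_rotate U).measurable.aemeasurable hf.aestronglyMeasurable]

/-- integration by parts -/
lemma integral_deriv_zero {d k : ℕ} {μ : Measure (Stiefel d k)} (hμ : IsHaarStiefel μ)
    (a : Matrix (Fin d) (Fin d) ℝ) (ha : a.transpose = -a) {u u' : Stiefel d k → ℝ}
    (hu : Continuous u) (hu' : Continuous u')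
    (h : ∀ θ t, HasDerivAt (fun s => u (stiefelRotate (flow a ha s) θ))
      (u' (stiefelRotate (flow a ha t) θ)) t) :
    ∫ θ, u' θ ∂μ = 0 := by
  have := hμ.1
  obtain ⟨C, hC⟩ := exists_bound_cont hu'
  have key := hasDerivAt_integral_of_dominated_loc_of_deriv_le (μ := μ) (𝕜 := ℝ)
    (F := fun s θ => u (stiefelRotate (flow a ha s) θ))
    (F' := fun s θ => u' (stiefelRotate (flow a ha s) θ)) (x₀ := 0) (s := Set.univ)
    (bound := fun _ => C) Filter.univ_mem
    (Filter.Eventually.of_forall fun s => (hu.comp (continuous_rotate _)).aestronglyMeasurable)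
    (integrable_of_cont (hu.comp (continuous_rotate _)))
    ((hu'.comp (continuous_rotate _)).aestronglyMeasurable)
    (Filter.Eventually.of_forall fun θ s _ => hC _)
    (integrable_const C)
    (Filter.Eventually.of_forall fun θ s _ => h θ s)
  have h2 := key.2
  simp only [integral_rotate hμ _ hu, integral_rotate hμ _ hu'] at h2
  exact h2.unique (hasDerivAt_const _ _)

lemma second_deriv_le {h h' : ℝ → ℝ} {c : ℝ} (h1 : ∀ t, HasDerivAt h (h' t) t)
    (h2 : HasDerivAt h' c 0) (hmax : ∀ t, h t ≤ h 0) : c ≤ 0 := by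
  by_contra hc
  push Not at hc
  have e1 : deriv h = h' := funext fun t => (h1 t).deriv
  have hlm : IsLocalMax h 0 := Filter.Eventually.of_forall hmax
  have hmin : IsLocalMin h 0 := by
    refine isLocalMin_of_deriv_deriv_pos ?_ ?_ (h1 0).continuousAt
    · rw [e1, h2.deriv]; exact hc
    · exact hlm.deriv_eq_zero
  have hconst : h =ᶠ[nhds 0] fun _ => h 0 := by
    filter_upwards [hmin, hlm] with t ht1 ht2
    exact le_antisymm ht2 ht1
  have hd : deriv h =ᶠ[nhds 0] deriv (fun _ => h 0) := hconst.deriv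
  have : deriv (deriv h) 0 = 0 := by
    rw [hd.deriv_eq]
    simp
  rw [e1, h2.deriv] at this
  linarith

/-- carré du champ as polynomial -/
def gam {d k : ℕ} (p q : MPoly d k) : MPoly d k :=
  ∑ i, ∑ j, lieD (skewE i j) p * lieD (skewE i j) q

lemma ev_gam {d k : ℕ} (p q : MPoly d k) (θ : Stiefel d k) :
    ev (gam p q) θ = ∑ i, ∑ j, ev (lieD (skewE i j) p) θ * ev (lieD (skewE i j) q) θ := by
  simp [gam, ev]

lemma ev_gam_nonneg {d k : ℕ} (p : MPoly d k) (θ : Stiefel d k) : 0 ≤ ev (gam p p) θ := by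
  rw [ev_gam]
  exact Finset.sum_nonneg fun i _ => Finset.sum_nonneg fun j _ => mul_self_nonneg _

lemma ev_gam_cs {d k : ℕ} (p q : MPoly d k) (θ : Stiefel d k) :
    |ev (gam p q) θ| ≤ √(ev (gam p p) θ) * √(ev (gam q q) θ) := by
  rw [← Real.sqrt_mul (ev_gam_nonneg p θ)]
  apply Real.abs_le_sqrt
  simp only [ev_gam, ← Fintype.sum_prod_type']
  have := Finset.sum_mul_sq_le_sq_mul_sq (Finset.univ : Finset (Fin d × Fin d))
    (fun x => ev (lieD (skewE x.1 x.2) p) θ) (fun x => ev (lieD (skewE x.1 x.2) q) θ)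
  simpa only [sq] using this

/-- Hessian square -/
def hess {d k : ℕ} (p : MPoly d k) (θ : Stiefel d k) : ℝ :=
  ∑ i, ∑ j, ∑ i', ∑ j', ev (lieD (skewE i j) (lieD (skewE i' j') p)) θ ^ 2

lemma ev_sub' {d k : ℕ} (p q : MPoly d k) (θ : Stiefel d k) : ev (p - q) θ = ev p θ - ev q θ := by
  simp [ev]

lemma hess_comb {d : ℕ} (f : Fin d → Fin d → Fin d → Fin d → ℝ) (g : Fin d → Fin d → ℝ)
    (hf0 : ∀ i j i' j', 0 ≤ f i j i' j') (hg0 : ∀ i l, 0 ≤ g i l)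
    (hfg : ∀ i j l, j ≠ i → j ≠ l → g i l ≤ 2 * f j l i j + 2 * f i j j l) :
    ((d : ℝ) - 2) * ∑ i, ∑ l, g i l ≤ 4 * ∑ i, ∑ j, ∑ i', ∑ j', f i j i' j' := by
  have b1 : ∑ j, ∑ l, ∑ i, f j l i j ≤ ∑ i, ∑ j, ∑ i', ∑ j', f i j i' j' := by
    refine Finset.sum_le_sum fun j _ => Finset.sum_le_sum fun l _ => Finset.sum_le_sum fun i _ => ?_
    exact Finset.single_le_sum (f := fun b => f j l i b) (fun b _ => hf0 _ _ _ _) (Finset.mem_univ j)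
  have b2 : ∑ i, ∑ j, ∑ l, f i j j l ≤ ∑ i, ∑ j, ∑ i', ∑ j', f i j i' j' := by
    refine Finset.sum_le_sum fun i _ => Finset.sum_le_sum fun j _ => ?_
    exact Finset.single_le_sum (f := fun b => ∑ l, f i j b l)
      (fun b _ => Finset.sum_nonneg fun _ _ => hf0 _ _ _ _) (Finset.mem_univ j)
  have c1 : ∑ j, ∑ l, ∑ i, f j l i j = ∑ i, ∑ l, ∑ j, f j l i j := by
    rw [Finset.sum_comm]
    conv_rhs => rw [Finset.sum_comm]
    refine Finset.sum_congr rfl fun l _ => Finset.sum_comm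
  have c2 : ∑ i, ∑ j, ∑ l, f i j j l = ∑ i, ∑ l, ∑ j, f i j j l := by
    refine Finset.sum_congr rfl fun i _ => Finset.sum_comm
  have main : ((d : ℝ) - 2) * ∑ i, ∑ l, g i l
      ≤ ∑ i, ∑ l, ∑ j, (2 * f j l i j + 2 * f i j j l) := by
    rw [Finset.mul_sum]
    refine Finset.sum_le_sum fun i _ => ?_
    rw [Finset.mul_sum]
    refine Finset.sum_le_sum fun l _ => ?_
    set s : Finset (Fin d) := Finset.univ \ {i, l} with hs
    have hcard : (d : ℝ) - 2 ≤ s.card := by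
      have h1 : d - 2 ≤ s.card := by
        rw [hs, Finset.card_sdiff]
        simp only [Finset.inter_univ, Finset.card_univ, Fintype.card_fin]
        have : ({i, l} : Finset (Fin d)).card ≤ 2 := Finset.card_le_two
        omega
      have h2 : d ≤ s.card + 2 := by omega
      have : (d : ℝ) ≤ s.card + 2 := by exact_mod_cast h2
      linarith
    calc ((d : ℝ) - 2) * g i l
        ≤ s.card * g i l := mul_le_mul_of_nonneg_right hcard (hg0 _ _)
      _ = ∑ j ∈ s, g i l := by simp
      _ ≤ ∑ j ∈ s, (2 * f j l i j + 2 * f i j j l) := by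
          refine Finset.sum_le_sum fun j hj => ?_
          simp only [hs, Finset.mem_sdiff, Finset.mem_univ, true_and, Finset.mem_insert,
            Finset.mem_singleton, not_or] at hj
          exact hfg i j l hj.1 hj.2
      _ ≤ _ := Finset.sum_le_sum_of_subset_of_nonneg (Finset.subset_univ _) fun j _ _ => by
          have := hf0 j l i j
          have := hf0 i j j l
          linarith
  simp only [Finset.sum_add_distrib, ← Finset.mul_sum] at main
  rw [← c1, ← c2] at main
  linarith

lemma hess_ge {d k : ℕ} (p : MPoly d k) (θ : Stiefel d k) :
    ((d : ℝ) - 2) * ev (gam p p) θ ≤ 4 * hess p θ := by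
  rw [ev_gam]
  refine hess_comb (fun i j i' j' => ev (lieD (skewE i j) (lieD (skewE i' j') p)) θ ^ 2)
    (fun i l => ev (lieD (skewE i l) p) θ * ev (lieD (skewE i l) p) θ)
    (fun _ _ _ _ => sq_nonneg _) (fun _ _ => mul_self_nonneg _) ?_
  intro i j l h1 h2
  rw [skewE_triple i j l h1 h2 p, ev_sub']
  generalize ev (lieD (skewE j l) (lieD (skewE i j) p)) θ = x
  generalize ev (lieD (skewE i j) (lieD (skewE j l) p)) θ = y
  nlinarith [sq_nonneg (x + y)]

lemma casimir_sq {d k : ℕ} (q : MPoly d k) :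
    casimir (q * q) = 2 * (q * casimir q) +
      2 * ∑ i, ∑ j, lieD (skewE i j) q * lieD (skewE i j) q := by
  simp only [casimir_apply, Finset.mul_sum, ← Finset.sum_add_distrib]
  refine Finset.sum_congr rfl fun i _ => Finset.sum_congr rfl fun j _ => ?_
  simp only [Derivation.leibniz, smul_eq_mul, map_add]
  ring

lemma bochner {d k : ℕ} (p : MPoly d k) (θ : Stiefel d k) :
    ev (casimir (gam p p)) θ = 2 * ev (gam p (casimir p)) θ + 2 * hess p θ := by
  have h1 : casimir (gam p p) = 2 * gam p (casimir p) +
      2 * ∑ i', ∑ j', ∑ i, ∑ j, lieD (skewE i j) (lieD (skewE i' j') p) *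
        lieD (skewE i j) (lieD (skewE i' j') p) := by
    simp only [gam, map_sum, casimir_sq, casimir_comm _ (skewE_transpose _ _), Finset.mul_sum,
      ← Finset.sum_add_distrib]
  have h2 : hess p θ = ∑ i', ∑ j', ∑ i, ∑ j, ev (lieD (skewE i j) (lieD (skewE i' j') p)) θ ^ 2 := by
    unfold hess
    simp only [← Fintype.sum_prod_type']
    have := Finset.sum_comm (s := (Finset.univ : Finset (Fin d × Fin d)))
      (t := (Finset.univ : Finset (Fin d × Fin d)))
      (f := fun a b => ev (lieD (skewE a.1 a.2) (lieD (skewE b.1 b.2) p)) θ ^ 2)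
    simpa only [Fintype.sum_prod_type] using this
  rw [h1, h2]
  simp [ev, sq]

/-- gradient estimate from the maximum principle -/
lemma grad_est {d k : ℕ} (hd : 3 ≤ d) (p : MPoly d k) (G : ℝ) (hG0 : 0 ≤ G)
    (hG : ∀ θ : Stiefel d k, √(ev (gam (casimir p) (casimir p)) θ) ≤ G) (θ : Stiefel d k) :
    √(ev (gam p p) θ) ≤ G / (((d : ℝ) - 2) / 4) := by
  have : Nonempty (Stiefel d k) := ⟨θ⟩
  obtain ⟨θ₀, -, hmax⟩ := isCompact_univ.exists_isMaxOn (Set.univ_nonempty)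
    (continuous_ev (gam p p) : Continuous (ev (gam p p) : Stiefel d k → ℝ)).continuousOn
  have hmax' : ∀ η, ev (gam p p) η ≤ ev (gam p p) θ₀ := fun η => hmax (Set.mem_univ η)
  have hneg : ev (casimir (gam p p)) θ₀ ≤ 0 := by
    have : ev (casimir (gam p p)) θ₀ =
        ∑ i, ∑ j, ev (lieD (skewE i j) (lieD (skewE i j) (gam p p))) θ₀ := by
      rw [casimir_apply]; simp [ev]
    rw [this]
    refine Finset.sum_nonpos fun i _ => Finset.sum_nonpos fun j _ => ?_
    refine second_deriv_le
      (fun t => ev_flow_deriv (skewE i j) (skewE_transpose i j) t (gam p p) θ₀)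
      (ev_lieD_eq_deriv (skewE i j) (skewE_transpose i j) _ θ₀) ?_
    intro t
    rw [rotate_flow_zero]
    exact hmax' _
  rw [bochner] at hneg
  have h1 := hess_ge p θ₀
  have h2 := ev_gam_cs p (casimir p) θ₀
  have hd' : (3:ℝ) ≤ d := by exact_mod_cast hd
  set M := √(ev (gam p p) θ₀) with hM
  have hM0 : 0 ≤ M := Real.sqrt_nonneg _
  have hMM : M * M = ev (gam p p) θ₀ := Real.mul_self_sqrt (ev_gam_nonneg p θ₀)
  have h3 : |ev (gam p (casimir p)) θ₀| ≤ M * G :=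
    h2.trans (mul_le_mul_of_nonneg_left (hG θ₀) hM0)
  have h4 := neg_abs_le (ev (gam p (casimir p)) θ₀)
  have h5 : ((d : ℝ) - 2) / 4 * (M * M) ≤ M * G := by rw [hMM]; linarith
  have h6 : M ≤ G / (((d : ℝ) - 2) / 4) := by
    rw [le_div_iff₀ (by linarith)]
    rcases hM0.eq_or_lt with h | h
    · rw [← h]; simpa using hG0
    · nlinarith
  exact (Real.sqrt_le_sqrt (hmax' θ)).trans h6


/-- affine functions of the entries -/
def affS (d k : ℕ) : Submodule ℝ (MPoly d k) :=
  Submodule.span ℝ (insert 1 (Set.range MvPolynomial.X))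

lemma X_mem_affS {d k : ℕ} (x : Fin d × Fin k) : (MvPolynomial.X x : MPoly d k) ∈ affS d k :=
  Submodule.subset_span (Set.mem_insert_of_mem _ ⟨x, rfl⟩)

lemma one_mem_affS {d k : ℕ} : (1 : MPoly d k) ∈ affS d k :=
  Submodule.subset_span (Set.mem_insert _ _)

lemma lieD_affS {d k : ℕ} (a : Matrix (Fin d) (Fin d) ℝ) (p : MPoly d k) (hp : p ∈ affS d k) :
    lieD a p ∈ affS d k := by
  induction hp using Submodule.span_induction with
  | mem x hx =>
    rcases hx with rfl | ⟨x, rfl⟩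
    · simp
    · rw [lieD_X]
      exact Submodule.sum_mem _ fun j _ => Submodule.smul_mem _ _ (X_mem_affS _)
  | zero => simp
  | add x y _ _ hx hy => rw [map_add]; exact add_mem hx hy
  | smul r x _ hx => rw [Derivation.map_smul]; exact Submodule.smul_mem _ _ hx

lemma lieD_affS_pow {d k : ℕ} (a : Matrix (Fin d) (Fin d) ℝ) (n : ℕ) :
    ∀ p : MPoly d k, p ∈ affS d k ^ n → lieD a p ∈ affS d k ^ n := by
  induction n with
  | zero =>
    intro p hp
    rw [pow_zero, Submodule.mem_one] at hp
    obtain ⟨r, rfl⟩ := hp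
    simp
  | succ n ih =>
    intro p hp
    rw [pow_succ] at hp ⊢
    induction hp using Submodule.mul_induction_on' with
    | mem_mul_mem x hx y hy =>
      rw [Derivation.leibniz, smul_eq_mul, smul_eq_mul, mul_comm y]
      exact add_mem (Submodule.mul_mem_mul hx (lieD_affS a y hy))
        (Submodule.mul_mem_mul (ih x hx) hy)
    | add x _ y _ hx hy => rw [map_add]; exact add_mem hx hy

lemma finite_affS_pow (d k n : ℕ) : Module.Finite ℝ (affS d k ^ n : Submodule ℝ (MPoly d k)) := by
  rw [Module.Finite.iff_fg]
  apply Submodule.FG.pow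
  exact Submodule.fg_span ((Set.finite_range _).insert _)

/-- evaluation as a linear map -/
def evL (d k : ℕ) : MPoly d k →ₗ[ℝ] (Stiefel d k → ℝ) where
  toFun := ev
  map_add' p q := by funext θ; simp [ev]
  map_smul' r p := by funext θ; simp [ev]

/-- flip invariant polynomials of bounded degree -/
def VS (d : ℕ) {k : ℕ} (m0 : Fin k) (n : ℕ) : Submodule ℝ (MPoly d k) where
  carrier := {p | p ∈ affS d k ^ n ∧ ∀ θ : Stiefel d k, ev p (flipS m0 θ) = ev p θ}
  add_mem' := by
    rintro p q ⟨hp, hp'⟩ ⟨hq, hq'⟩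
    refine ⟨add_mem hp hq, fun θ => ?_⟩
    have h1 := hp' θ
    have h2 := hq' θ
    simp only [ev, map_add] at *
    rw [h1, h2]
  zero_mem' := ⟨zero_mem _, fun θ => by simp [ev]⟩
  smul_mem' := by
    rintro r p ⟨hp, hp'⟩
    refine ⟨Submodule.smul_mem _ _ hp, fun θ => ?_⟩
    have h1 := hp' θ
    simp only [ev, MvPolynomial.smul_eval] at *
    rw [h1]

lemma mem_VS {d k : ℕ} {m0 : Fin k} {n : ℕ} {p : MPoly d k} :
    p ∈ VS d m0 n ↔ p ∈ affS d k ^ n ∧ ∀ θ : Stiefel d k, ev p (flipS m0 θ) = ev p θ := Iff.rfl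

lemma finite_VS (d k n : ℕ) (m0 : Fin k) : Module.Finite ℝ (VS d m0 n) := by
  have := finite_affS_pow d k n
  have hle : VS d m0 n ≤ affS d k ^ n := fun p hp => hp.1
  exact Submodule.finiteDimensional_of_le hle

lemma lieD_VS {d k : ℕ} {m0 : Fin k} {n : ℕ} (a : Matrix (Fin d) (Fin d) ℝ) (ha : a.transpose = -a)
    {p : MPoly d k} (hp : p ∈ VS d m0 n) : lieD a p ∈ VS d m0 n := by
  refine ⟨lieD_affS_pow a n p hp.1, fun θ => ?_⟩
  have h1 := ev_lieD_eq_deriv a ha p (flipS m0 θ)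
  simp only [← flip_rotate, hp.2] at h1
  exact h1.unique (ev_lieD_eq_deriv a ha p θ)

lemma casimir_VS {d k : ℕ} {m0 : Fin k} {n : ℕ}
    {p : MPoly d k} (hp : p ∈ VS d m0 n) : casimir p ∈ VS d m0 n := by
  rw [casimir_apply]
  exact Submodule.sum_mem _ fun i _ => Submodule.sum_mem _ fun j _ =>
    lieD_VS _ (skewE_transpose i j) (lieD_VS _ (skewE_transpose i j) hp)

lemma C_VS {d k : ℕ} {m0 : Fin k} {n : ℕ} (r : ℝ) : (MvPolynomial.C r : MPoly d k) ∈ VS d m0 n := by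
  refine ⟨?_, fun θ => by simp [ev]⟩
  have : (MvPolynomial.C r : MPoly d k) = r • (1 : MPoly d k) ^ n := by
    rw [one_pow, MvPolynomial.smul_eq_C_mul, mul_one]
  rw [this]
  exact Submodule.smul_mem _ _ (Submodule.pow_mem_pow _ one_mem_affS n)

lemma integral_casimir {d k : ℕ} {μ : Measure (Stiefel d k)} (hμ : IsHaarStiefel μ) (p : MPoly d k) :
    ∫ θ, ev (casimir p) θ ∂μ = 0 := by
  have := hμ.1
  have e : ∀ θ : Stiefel d k, ev (casimir p) θ =
      ∑ i, ∑ j, ev (lieD (skewE i j) (lieD (skewE i j) p)) θ := by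
    intro θ; rw [casimir_apply]; simp [ev]
  simp only [e]
  rw [integral_finsetSum _ fun i _ => integrable_of_cont (by
    exact continuous_finsetSum _ fun j _ => continuous_ev _)]
  refine Finset.sum_eq_zero fun i _ => ?_
  rw [integral_finsetSum _ fun i _ => integrable_of_cont (continuous_ev _)]
  refine Finset.sum_eq_zero fun j _ => ?_
  exact integral_deriv_zero hμ (skewE i j) (skewE_transpose i j) (continuous_ev _) (continuous_ev _)
    fun θ t => ev_flow_deriv _ _ t _ θ

lemma lieD_zero_of_gam {d k : ℕ} (p : MPoly d k) (θ : Stiefel d k) (h : ev (gam p p) θ = 0)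
    (a : Matrix (Fin d) (Fin d) ℝ) (ha : a.transpose = -a) : ev (lieD a p) θ = 0 := by
  rw [ev_gam, Finset.sum_eq_zero_iff_of_nonneg
    (fun i _ => Finset.sum_nonneg fun j _ => mul_self_nonneg _)] at h
  have h2 : ∀ i j, ev (lieD (skewE i j) p) θ = 0 := by
    intro i j
    have h1 := h i (Finset.mem_univ _)
    rw [Finset.sum_eq_zero_iff_of_nonneg (fun j _ => mul_self_nonneg _)] at h1
    exact mul_self_eq_zero.1 (h1 j (Finset.mem_univ _))
  rw [skew_expand a ha, ← Fintype.sum_prod_type', lieD_lin]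
  have : ∀ x : Fin d × Fin d, (MvPolynomial.eval (cS θ)) (lieD (skewE x.1 x.2) p) = 0 :=
    fun x => h2 x.1 x.2
  simp [ev, this]

lemma poisson {d k : ℕ} (hd : 3 ≤ d) {m0 : Fin k} {n : ℕ} {μ : Measure (Stiefel d k)}
    (hμ : IsHaarStiefel μ) {f : MPoly d k} (hf : f ∈ VS d m0 n) :
    ∃ g : MPoly d k, ∀ θ, ev f θ = ∫ η, ev f η ∂μ - ev (casimir g) θ := by
  have := hμ.1
  have := finite_VS d k n m0
  let T : VS d m0 n →ₗ[ℝ] VS d m0 n :=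
    { toFun := fun g => ⟨MvPolynomial.C (∫ η, ev g.1 η ∂μ) - casimir g.1,
        sub_mem (C_VS _) (casimir_VS g.2)⟩
      map_add' := by
        intro x y
        apply Subtype.ext
        have : ∫ η, ev (x.1 + y.1) η ∂μ = ∫ η, ev x.1 η ∂μ + ∫ η, ev y.1 η ∂μ := by
          rw [← integral_add (integrable_of_cont (continuous_ev _)) (integrable_of_cont (continuous_ev _))]
          simp [ev]
        simp only [Submodule.coe_add, this, map_add]
        abel
      map_smul' := by
        intro r x
        apply Subtype.ext
        have : ∫ η, ev (r • x.1) η ∂μ = r * ∫ η, ev x.1 η ∂μ := by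
          rw [← integral_const_mul]
          simp [ev]
        simp only [Submodule.coe_smul, this, map_smul, smul_sub, RingHom.id_apply]
        congr 1
        rw [MvPolynomial.smul_eq_C_mul, map_mul] }
  have hT : ∀ g : VS d m0 n, ∀ θ, ev (T g).1 θ = ∫ η, ev g.1 η ∂μ - ev (casimir g.1) θ := by
    intro g θ
    simp [T, ev]
  let E : VS d m0 n →ₗ[ℝ] (Stiefel d k → ℝ) := evL d k ∘ₗ (VS d m0 n).subtype
  have hE : ∀ g θ, E g θ = ev g.1 θ := fun _ _ => rfl
  let S := E ∘ₗ T
  have hS : ∀ g θ, S g θ = ∫ η, ev g.1 η ∂μ - ev (casimir g.1) θ := fun g θ => hT g θ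
  have hker : LinearMap.ker S = LinearMap.ker E := by
    ext g
    rw [LinearMap.mem_ker, LinearMap.mem_ker]
    constructor
    · intro h
      have h1 : ∀ θ, ∫ η, ev g.1 η ∂μ = ev (casimir g.1) θ := fun θ => by
        have := congrFun h θ
        rw [hS] at this
        simp only [Pi.zero_apply] at this
        linarith
      have h2 : ∫ η, ev g.1 η ∂μ = 0 := by
        have h3 := integral_casimir hμ g.1
        simp only [← h1] at h3
        simpa using h3
      have h4 : ∀ θ, ev (casimir g.1) θ = ev (0 : MPoly d k) θ := fun θ => by
        rw [← h1, h2]; simp [ev]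
      have h5 : ∀ θ, ev (gam (casimir g.1) (casimir g.1)) θ = 0 := by
        intro θ
        rw [ev_gam]
        refine Finset.sum_eq_zero fun i _ => Finset.sum_eq_zero fun j _ => ?_
        rw [ev_lieD_congr _ (skewE_transpose i j) _ _ h4 θ]
        simp [ev]
      have h6 : ∀ θ, ev (gam g.1 g.1) θ = 0 := by
        intro θ
        have := grad_est hd g.1 0 le_rfl (fun θ => by rw [h5]; simp) θ
        rw [zero_div] at this
        have h7 := Real.sqrt_eq_zero'.1 (le_antisymm this (Real.sqrt_nonneg _))
        exact le_antisymm h7 (ev_gam_nonneg _ _)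
      have h8 := ev_const m0 g.1 g.2.2 (fun a ha θ => lieD_zero_of_gam g.1 θ (h6 θ) a ha)
      funext θ
      rw [hE]
      have : ∫ η, ev g.1 η ∂μ = ev g.1 θ := by
        simp [h8 _ θ]
      rw [← this, h2]; rfl
    · intro h
      have h1 : ∀ θ, ev g.1 θ = ev (0 : MPoly d k) θ := fun θ => by
        have := congrFun h θ
        rw [hE] at this
        rw [this]; simp [ev]
      funext θ
      rw [hS]
      have h2 : ev (casimir g.1) θ = 0 := by
        rw [casimir_apply]
        have : ∀ i j, ev (lieD (skewE i j) (lieD (skewE i j) g.1)) θ = 0 := by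
          intro i j
          rw [ev_lieD_congr _ (skewE_transpose i j) _ (0 : MPoly d k) _ θ]
          · simp [ev]
          · intro η
            rw [ev_lieD_congr _ (skewE_transpose i j) _ (0 : MPoly d k) h1 η]
            simp [ev]
        simp only [ev] at this
        simp [ev, this]
      rw [h2]
      simp only [h1]
      simp [ev]
  have hle : LinearMap.range S ≤ LinearMap.range E := LinearMap.range_comp_le_range _ _
  have hrank : Module.finrank ℝ (LinearMap.range S) = Module.finrank ℝ (LinearMap.range E) := by
    have a1 := S.finrank_range_add_finrank_ker
    have a2 := E.finrank_range_add_finrank_ker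
    rw [hker] at a1
    omega
  have heq := Submodule.eq_of_le_of_finrank_eq hle hrank
  have hmem : E ⟨f, hf⟩ ∈ LinearMap.range S := by rw [heq]; exact ⟨_, rfl⟩
  obtain ⟨g, hg⟩ := hmem
  have hfg : ∀ θ, ev f θ = ∫ η, ev g.1 η ∂μ - ev (casimir g.1) θ := fun θ => by
    have := congrFun hg θ
    rw [hS, hE] at this
    exact this.symm
  refine ⟨g.1, fun θ => ?_⟩
  have : ∫ η, ev f η ∂μ = ∫ η, ev g.1 η ∂μ := by
    simp only [hfg]
    rw [integral_sub (integrable_const _) (integrable_of_cont (continuous_ev _)), integral_casimir hμ]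
    simp
  rw [this]; exact hfg θ


lemma ev_gam_congr {d k : ℕ} (p q : MPoly d k) (c : ℝ) (h : ∀ θ, ev p θ = c - ev q θ)
    (θ : Stiefel d k) : ev (gam q q) θ = ev (gam p p) θ := by
  rw [ev_gam, ev_gam]
  refine Finset.sum_congr rfl fun i _ => Finset.sum_congr rfl fun j _ => ?_
  have h1 := ev_lieD_congr (skewE i j) (skewE_transpose i j) p (MvPolynomial.C c - q)
    (fun η => by rw [h η]; simp [ev]) θ
  have h2 : ev (lieD (skewE i j) (MvPolynomial.C c - q)) θ = - ev (lieD (skewE i j) q) θ := by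
    rw [map_sub, MvPolynomial.derivation_C]
    simp [ev]
  rw [h1, h2]
  ring

lemma ibp_exp {d k : ℕ} {μ : Measure (Stiefel d k)} (hμ : IsHaarStiefel μ) (f g : MPoly d k)
    (m l : ℝ) :
    ∫ θ, ev (casimir g) θ * exp (l * (ev f θ - m)) ∂μ =
      - (l * ∫ θ, ev (gam g f) θ * exp (l * (ev f θ - m)) ∂μ) := by
  have := hμ.1
  have hE : Continuous fun θ : Stiefel d k => exp (l * (ev f θ - m)) := by
    have := continuous_ev f
    fun_prop
  have key : ∀ i j, ∫ θ, (ev (lieD (skewE i j) (lieD (skewE i j) g)) θ * exp (l * (ev f θ - m))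
      + ev (lieD (skewE i j) g) θ * (exp (l * (ev f θ - m)) * (l * ev (lieD (skewE i j) f) θ))) ∂μ
        = 0 := by
    intro i j
    have c1 := continuous_ev (lieD (skewE i j) (lieD (skewE i j) g))
    have c2 := continuous_ev (lieD (skewE i j) g)
    have c3 := continuous_ev (lieD (skewE i j) f)
    refine integral_deriv_zero hμ (skewE i j) (skewE_transpose i j)
      (u := fun θ => ev (lieD (skewE i j) g) θ * exp (l * (ev f θ - m))) (c2.mul hE)
      ((c1.mul hE).add (c2.mul (hE.mul (continuous_const.mul c3)))) ?_
    intro θ t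
    have h1 := ev_flow_deriv _ (skewE_transpose i j) t (lieD (skewE i j) g) θ
    have h2 := ev_flow_deriv _ (skewE_transpose i j) t f θ
    exact h1.mul (((h2.sub_const m).const_mul l).exp)
  have hsum : ∫ θ, (ev (casimir g) θ * exp (l * (ev f θ - m)) +
      l * (ev (gam g f) θ * exp (l * (ev f θ - m)))) ∂μ = 0 := by
    have e : ∀ θ : Stiefel d k, (ev (casimir g) θ * exp (l * (ev f θ - m)) +
      l * (ev (gam g f) θ * exp (l * (ev f θ - m)))) = ∑ x : Fin d × Fin d,
       (ev (lieD (skewE x.1 x.2) (lieD (skewE x.1 x.2) g)) θ * exp (l * (ev f θ - m))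
      + ev (lieD (skewE x.1 x.2) g) θ *
        (exp (l * (ev f θ - m)) * (l * ev (lieD (skewE x.1 x.2) f) θ))) := by
      intro θ
      have e1 : ev (casimir g) θ =
          ∑ i, ∑ j, ev (lieD (skewE i j) (lieD (skewE i j) g)) θ := by
        rw [casimir_apply]; simp [ev]
      rw [e1, ev_gam, ← Fintype.sum_prod_type', ← Fintype.sum_prod_type', Finset.sum_mul,
        Finset.sum_mul, Finset.mul_sum, ← Finset.sum_add_distrib]
      refine Finset.sum_congr rfl fun x _ => ?_
      ring
    simp only [e]
    rw [integral_finsetSum _ fun x _ => integrable_of_cont (by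
      have c1 := continuous_ev (lieD (skewE x.1 x.2) (lieD (skewE x.1 x.2) g))
      have c2 := continuous_ev (lieD (skewE x.1 x.2) g)
      have c3 := continuous_ev (lieD (skewE x.1 x.2) f)
      exact ((c1.mul hE).add (c2.mul (hE.mul (continuous_const.mul c3)))))]
    exact Finset.sum_eq_zero fun x _ => key x.1 x.2
  have i1 : Integrable (fun θ => ev (casimir g) θ * exp (l * (ev f θ - m))) μ :=
    integrable_of_cont ((continuous_ev _).mul hE)
  have i2 : Integrable (fun θ => l * (ev (gam g f) θ * exp (l * (ev f θ - m)))) μ :=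
    integrable_of_cont (continuous_const.mul ((continuous_ev _).mul hE))
  rw [integral_add i1 i2, integral_const_mul] at hsum
  linarith

/-- Differential inequality implies the mgf bound. -/
lemma mgf_ode {d k : ℕ} {μ : Measure (Stiefel d k)} [IsProbabilityMeasure μ]
    {u : Stiefel d k → ℝ} (hu : Continuous u) (A : ℝ)
    (h : ∀ l : ℝ, 0 ≤ l → ∫ θ, u θ * exp (l * u θ) ∂μ ≤ l * A * ∫ θ, exp (l * u θ) ∂μ)
    (l : ℝ) (hl : 0 ≤ l) : ∫ θ, exp (l * u θ) ∂μ ≤ exp (l ^ 2 * A / 2) := by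
  have hInt : ∀ t : ℝ, Integrable (fun θ => exp (t * u θ)) μ := fun t =>
    integrable_of_cont (by fun_prop)
  have hset : integrableExpSet u μ = Set.univ := by
    ext t; simp [integrableExpSet, hInt t]
  have hd : ∀ t, HasDerivAt (mgf u μ) (∫ θ, u θ * exp (t * u θ) ∂μ) t := fun t =>
    hasDerivAt_mgf (by rw [hset]; simp)
  let φ : ℝ → ℝ := fun t => mgf u μ t * exp (-(t ^ 2 * A / 2))
  have hφ : ∀ t, HasDerivAt φ ((∫ θ, u θ * exp (t * u θ) ∂μ) * exp (-(t ^ 2 * A / 2)) +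
      mgf u μ t * (exp (-(t ^ 2 * A / 2)) * (-(t * A)))) t := by
    intro t
    have h2 : HasDerivAt (fun t : ℝ => -(t ^ 2 * A / 2)) (-(t * A)) t := by
      have := ((((hasDerivAt_pow 2 t)).mul_const A).div_const 2).fun_neg
      have e : -(t * A) = -(((2 : ℕ) : ℝ) * t ^ (2 - 1) * A / 2) := by
        norm_num
        ring
      rw [e]
      exact this
    exact (hd t).mul h2.exp
  have hanti : AntitoneOn φ (Set.Ici 0) := by
    apply antitoneOn_of_deriv_nonpos (convex_Ici 0)
    · exact fun t _ => (hφ t).continuousAt.continuousWithinAt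
    · exact fun t _ => (hφ t).differentiableAt.differentiableWithinAt
    · intro t ht
      rw [interior_Ici] at ht
      rw [(hφ t).deriv]
      have h1 := h t (le_of_lt ht)
      have h2 := exp_pos (-(t ^ 2 * A / 2))
      have e : mgf u μ t = ∫ θ, exp (t * u θ) ∂μ := rfl
      rw [← e] at h1
      nlinarith [mul_le_mul_of_nonneg_right h1 h2.le]
  have h3 := hanti (Set.mem_Ici.2 le_rfl) (Set.mem_Ici.2 hl) hl
  have h0 : φ 0 = 1 := by simp [φ]
  rw [h0] at h3
  have h4 : (∫ θ, exp (l * u θ) ∂μ) * exp (-(l ^ 2 * A / 2)) ≤ 1 := h3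
  rw [Real.exp_neg, mul_inv_le_iff₀ (exp_pos _), one_mul] at h4
  exact h4

lemma mgf_poly {d k : ℕ} (hd : 3 ≤ d) {m0 : Fin k} {n : ℕ} {μ : Measure (Stiefel d k)}
    (hμ : IsHaarStiefel μ) {f : MPoly d k} (hf : f ∈ VS d m0 n) (G : ℝ) (hG0 : 0 ≤ G)
    (hG : ∀ θ : Stiefel d k, √(ev (gam f f) θ) ≤ G) (l : ℝ) (hl : 0 ≤ l) :
    ∫ θ, exp (l * (ev f θ - ∫ η, ev f η ∂μ)) ∂μ ≤
      exp (l ^ 2 * (G / (((d : ℝ) - 2) / 4) * G) / 2) := by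
  have := hμ.1
  obtain ⟨g, hg⟩ := poisson hd hμ hf
  have hg1 : ∀ θ, √(ev (gam g g) θ) ≤ G / (((d : ℝ) - 2) / 4) :=
    grad_est hd g G hG0 fun θ => by rw [ev_gam_congr f _ _ hg]; exact hG θ
  refine mgf_ode (u := fun θ => ev f θ - ∫ η, ev f η ∂μ) ((continuous_ev f).sub continuous_const)
    _ (fun t ht => ?_) l hl
  set m := ∫ η, ev f η ∂μ
  have hE : Continuous fun θ : Stiefel d k => exp (t * (ev f θ - m)) := by
    have := continuous_ev f
    fun_prop
  have e1 : ∀ θ, (ev f θ - m) * exp (t * (ev f θ - m)) =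
      -(ev (casimir g) θ * exp (t * (ev f θ - m))) := by
    intro θ
    rw [hg θ]; ring
  simp only [e1]
  rw [integral_neg, ibp_exp hμ, neg_neg, mul_assoc]
  refine mul_le_mul_of_nonneg_left ?_ ht
  rw [← integral_const_mul]
  refine integral_mono (integrable_of_cont ((continuous_ev _).mul hE))
    (integrable_of_cont (continuous_const.mul hE)) fun θ => ?_
  refine mul_le_mul_of_nonneg_right ?_ (exp_pos _).le
  refine (le_abs_self _).trans ((ev_gam_cs g f θ).trans ?_)
  exact mul_le_mul (hg1 θ) (hG θ) (sqrt_nonneg _) ((sqrt_nonneg _).trans (hg1 θ))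


lemma gam_le_of_lip {d k : ℕ} (f : MPoly d k) (θ : Stiefel d k) (L : ℝ) (hL : 0 ≤ L)
    (h : ∀ (a : Matrix (Fin d) (Fin d) ℝ), a.transpose = -a →
      |ev (lieD a f) θ| ≤ L * √(∑ i, ∑ j, a i j ^ 2)) :
    √(ev (gam f f) θ) ≤ 2 * L := by
  let a : Matrix (Fin d) (Fin d) ℝ := Matrix.of fun i j => ev (lieD (skewE i j) f) θ
  have ha : a.transpose = -a := by
    ext i j
    have : lieD (k := k) (skewE j i) = (-1 : ℝ) • lieD (skewE i j) := by
      rw [← lieD_smul, skewE_swap]; simp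
    simp [a, this, ev]
  have h1 := h a ha
  have e1 : ∑ i, ∑ j, a i j ^ 2 = ev (gam f f) θ := by
    rw [ev_gam]; simp [a, sq]
  have e2 : ev (lieD a f) θ = ev (gam f f) θ / 2 := by
    conv_lhs => rw [skew_expand a ha, ← Fintype.sum_prod_type', lieD_lin]
    rw [ev_gam, ← Fintype.sum_prod_type', Finset.sum_div]
    simp only [ev, map_sum, MvPolynomial.smul_eval]
    refine Finset.sum_congr rfl fun x _ => ?_
    simp only [a, Matrix.of_apply, ev]
    ring
  rw [e1, e2] at h1
  have h2 := ev_gam_nonneg f θ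
  have h3 := Real.mul_self_sqrt h2
  rw [abs_of_nonneg (by linarith)] at h1
  rcases (sqrt_nonneg (ev (gam f f) θ)).eq_or_lt with h0 | h0
  · rw [← h0]; linarith
  · by_contra hc
    push Not at hc
    nlinarith

/-- the kernel -/
def kap {d k : ℕ} (θ : Stiefel d k) (w : Fin d × Fin k → ℝ) : ℝ := k + ∑ x, cS θ x * w x

lemma poly_integral {d k : ℕ} {μ : Measure (Stiefel d k)} [IsProbabilityMeasure μ]
    {w : Stiefel d k → Fin d × Fin k → ℝ} (hw : Continuous w) (n : ℕ) :
    ∀ F : Stiefel d k → ℝ, Continuous F → ∃ p ∈ affS d k ^ n, ∀ θ : Stiefel d k,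
      ev p θ = ∫ η, F η * kap θ (w η) ^ n ∂μ := by
  have hk : ∀ θ : Stiefel d k, Continuous fun η => kap θ (w η) := by
    intro θ
    unfold kap
    exact continuous_const.add (continuous_finsetSum _ fun x _ =>
      continuous_const.mul ((continuous_apply x).comp hw))
  induction n with
  | zero =>
    intro F hF
    refine ⟨(∫ η, F η ∂μ) • (1 : MPoly d k), Submodule.smul_mem _ _ ?_, fun θ => ?_⟩
    · simpa using (Submodule.pow_mem_pow (affS d k) one_mem_affS 0)
    · simp [ev]
  | succ n ih =>
    intro F hF
    obtain ⟨p0, hp0, h0⟩ := ih (fun η => F η * k) (hF.mul continuous_const)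
    have hwx : ∀ x, Continuous fun η => F η * w η x := fun x =>
      hF.mul ((continuous_apply x).comp hw)
    choose p hp hpe using fun x => ih (fun η => F η * w η x) (hwx x)
    refine ⟨p0 * 1 + ∑ x, p x * MvPolynomial.X x, ?_, fun θ => ?_⟩
    · rw [pow_succ]
      exact add_mem (Submodule.mul_mem_mul hp0 one_mem_affS)
        (sum_mem fun x _ => Submodule.mul_mem_mul (hp x) (X_mem_affS x))
    · have e : ∀ η, F η * kap θ (w η) ^ (n + 1) = F η * k * kap θ (w η) ^ n +
          ∑ x, cS θ x * (F η * w η x * kap θ (w η) ^ n) := by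
        intro η
        have : ∑ x, cS θ x * (F η * w η x * kap θ (w η) ^ n) =
            (∑ x, cS θ x * w η x) * (F η * kap θ (w η) ^ n) := by
          rw [Finset.sum_mul]
          refine Finset.sum_congr rfl fun x _ => ?_
          ring
        rw [this, pow_succ]
        nth_rw 2 [kap]
        ring
      have c1 : Continuous fun η => F η * k * kap θ (w η) ^ n :=
        (hF.mul continuous_const).mul ((hk θ).pow n)
      have c2 : ∀ x, Continuous fun η => cS θ x * (F η * w η x * kap θ (w η) ^ n) := fun x =>
        continuous_const.mul ((hwx x).mul ((hk θ).pow n))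
      simp only [e]
      rw [integral_add (integrable_of_cont c1)
        (integrable_of_cont (continuous_finsetSum _ fun x _ => c2 x)),
        integral_finsetSum _ fun x _ => integrable_of_cont (c2 x), ← h0 θ]
      simp only [integral_const_mul, ← hpe]
      simp [ev, mul_comm]

lemma sum_cS {d k : ℕ} (θ η : Stiefel d k) :
    ∑ x, cS θ x * cS η x = ∑ m, ⟪θ.1 m, η.1 m⟫ := by
  rw [Fintype.sum_prod_type, Finset.sum_comm]
  refine Finset.sum_congr rfl fun m _ => ?_
  simp [PiLp.inner_apply, cS, mul_comm]

lemma kap_eq {d k : ℕ} (θ η : Stiefel d k) :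
    kap θ (cS η) = 2 * k - (∑ m, ‖θ.1 m - η.1 m‖ ^ 2) / 2 := by
  have h : ∀ m, ‖θ.1 m - η.1 m‖ ^ 2 = 2 - 2 * ⟪θ.1 m, η.1 m⟫ := by
    intro m
    rw [norm_sub_sq_real, θ.2.1 m, η.2.1 m]; ring
  simp only [h, kap, sum_cS, Finset.sum_sub_distrib, ← Finset.mul_sum]
  simp
  ring

lemma kap_nonneg {d k : ℕ} (θ η : Stiefel d k) : 0 ≤ kap θ (cS η) := by
  have h : ∀ m, -1 ≤ ⟪θ.1 m, η.1 m⟫ := by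
    intro m
    have := abs_real_inner_le_norm (θ.1 m) (η.1 m)
    rw [θ.2.1 m, η.2.1 m] at this
    exact (abs_le.1 (by simpa using this)).1
  have := Finset.sum_le_sum (s := Finset.univ) fun m _ => h m
  simp at this
  rw [kap, sum_cS]
  linarith

lemma kap_rotate {d k : ℕ} (U : EE d ≃ₗᵢ[ℝ] EE d) (θ η : Stiefel d k) :
    kap (stiefelRotate U θ) (cS (stiefelRotate U η)) = kap θ (cS η) := by
  rw [kap, kap, sum_cS, sum_cS]
  simp [stiefelRotate]

lemma kap_flip {d k : ℕ} (m0 : Fin k) (θ η : Stiefel d k) :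
    kap (flipS m0 θ) (cS η) = kap θ (cS (flipS m0 η)) := by
  rw [kap, kap, sum_cS, sum_cS]
  simp [flipS, real_inner_smul_left, real_inner_smul_right]

lemma flipS_flipS {d k : ℕ} (m0 : Fin k) (θ : Stiefel d k) : flipS m0 (flipS m0 θ) = θ := by
  apply Subtype.ext
  funext m
  simp [flipS, smul_smul, sgn_sq]

lemma continuous_kap {d k : ℕ} (θ : Stiefel d k) : Continuous fun η => kap θ (cS η) := by
  unfold kap
  exact continuous_const.add (continuous_finsetSum _ fun x _ =>
      continuous_const.mul ((continuous_apply x).comp continuous_cS))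

/-- normalization constant -/
def ZK {d k : ℕ} (μ : Measure (Stiefel d k)) (n : ℕ) (θ : Stiefel d k) : ℝ :=
  ∫ η, kap θ (cS η) ^ n ∂μ

/-- averaging against the peak kernel -/
def avg {d k : ℕ} (μ : Measure (Stiefel d k)) (n : ℕ) (F : Stiefel d k → ℝ) (θ : Stiefel d k) : ℝ :=
  (ZK μ n θ)⁻¹ * ∫ η, F η * kap θ (cS η) ^ n ∂μ

lemma ZK_rotate {d k : ℕ} {μ : Measure (Stiefel d k)} (hμ : IsHaarStiefel μ) (n : ℕ)
    (U : EE d ≃ₗᵢ[ℝ] EE d) (θ : Stiefel d k) : ZK μ n (stiefelRotate U θ) = ZK μ n θ := by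
  unfold ZK
  have hc : Continuous fun η => kap (stiefelRotate U θ) (cS η) ^ n := (continuous_kap _).pow n
  rw [← integral_rotate hμ U hc]
  simp only [kap_rotate]

lemma ZK_const {d k : ℕ} {μ : Measure (Stiefel d k)} (hμ : IsHaarStiefel μ) (n : ℕ)
    (θ θ' : Stiefel d k) : ZK μ n θ = ZK μ n θ' := by
  obtain ⟨U, rfl⟩ := exists_rotate θ θ'
  rw [ZK_rotate hμ]

lemma avg_rotate {d k : ℕ} {μ : Measure (Stiefel d k)} (hμ : IsHaarStiefel μ) (n : ℕ)
    {F : Stiefel d k → ℝ} (hF : Continuous F)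
    (U : EE d ≃ₗᵢ[ℝ] EE d) (θ : Stiefel d k) :
    avg μ n F (stiefelRotate U θ) = avg μ n (fun η => F (stiefelRotate U η)) θ := by
  unfold avg
  have hc : Continuous fun η => F η * kap (stiefelRotate U θ) (cS η) ^ n :=
    hF.mul ((continuous_kap _).pow n)
  rw [ZK_rotate hμ, ← integral_rotate hμ U hc]
  simp only [kap_rotate]

lemma avg_sub_le {d k : ℕ} {μ : Measure (Stiefel d k)} [IsProbabilityMeasure μ] (n : ℕ)
    {F F' : Stiefel d k → ℝ} (hF : Continuous F) (hF' : Continuous F') (M : ℝ) (hM0 : 0 ≤ M)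
    (hM : ∀ η, |F η - F' η| ≤ M) (θ : Stiefel d k) : |avg μ n F θ - avg μ n F' θ| ≤ M := by
  have hZ : 0 ≤ ZK μ n θ := integral_nonneg fun η => pow_nonneg (kap_nonneg _ _) _
  have hc := (continuous_kap θ).pow n
  have i1 : Integrable (fun η => F η * kap θ (cS η) ^ n) μ := integrable_of_cont (hF.mul hc)
  have i2 : Integrable (fun η => F' η * kap θ (cS η) ^ n) μ := integrable_of_cont (hF'.mul hc)
  have i3 : Integrable (fun η => M * kap θ (cS η) ^ n) μ :=
    integrable_of_cont (continuous_const.mul hc)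
  unfold avg
  rw [← mul_sub, ← integral_sub i1 i2, abs_mul, abs_of_nonneg (inv_nonneg.2 hZ)]
  have : |∫ η, (F η * kap θ (cS η) ^ n - F' η * kap θ (cS η) ^ n) ∂μ| ≤ M * ZK μ n θ := by
    unfold ZK
    rw [← integral_const_mul]
    rw [← Real.norm_eq_abs]
    refine norm_integral_le_of_norm_le i3 (Filter.Eventually.of_forall fun η => ?_)
    rw [← sub_mul, norm_mul, Real.norm_eq_abs, Real.norm_eq_abs,
      abs_of_nonneg (pow_nonneg (kap_nonneg θ η) n)]
    exact mul_le_mul_of_nonneg_right (hM η) (pow_nonneg (kap_nonneg θ η) n)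
  refine (mul_le_mul_of_nonneg_left this (inv_nonneg.2 hZ)).trans ?_
  rcases hZ.eq_or_lt with h | h
  · rw [← h]; simpa using hM0
  · rw [mul_comm M, ← mul_assoc, inv_mul_cancel₀ h.ne', one_mul]

instance instSCStiefel (d k : ℕ) : SecondCountableTopology (Stiefel d k) :=
  inferInstanceAs (SecondCountableTopology
    {θ : Fin k → EuclideanSpace ℝ (Fin d) // Orthonormal ℝ θ})

lemma open_pos {d k : ℕ} {μ : Measure (Stiefel d k)} (hμ : IsHaarStiefel μ) (θ : Stiefel d k)
    (u : Set (Stiefel d k)) (hu : IsOpen u) (hθ : θ ∈ u) : 0 < μ u := by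
  have := hμ.1
  obtain ⟨θ0, -, h0⟩ := exists_mem_forall_mem_nhdsWithin_pos_measure (μ := μ)
    (s := (Set.univ : Set (Stiefel d k))) (by simp)
  obtain ⟨U, hU⟩ := exists_rotate θ0 θ
  rw [← hμ.2 U, Measure.map_apply (continuous_rotate U).measurable hu.measurableSet]
  apply h0
  rw [nhdsWithin_univ]
  exact (hu.preimage (continuous_rotate U)).mem_nhds (by simpa [hU] using hθ)

lemma avg_tendsto {d k : ℕ} (hk : 0 < k) {μ : Measure (Stiefel d k)} (hμ : IsHaarStiefel μ)
    {F : Stiefel d k → ℝ} (hF : Continuous F) (θ : Stiefel d k) :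
    Filter.Tendsto (fun n => avg μ n F θ) Filter.atTop (nhds (F θ)) := by
  have := hμ.1
  have key := tendsto_setIntegral_pow_smul_of_unique_maximum_of_isCompact_of_measure_nhdsWithin_pos
    (μ := μ) (s := (Set.univ : Set (Stiefel d k))) (x₀ := θ) (g := F) isCompact_univ
    (fun u hu hθ => by rw [Set.inter_univ]; exact open_pos hμ θ u hu hθ)
    (c := fun η => kap θ (cS η)) (continuous_kap θ).continuousOn
    (fun η _ hne => by
      have : 0 < ∑ m, ‖θ.1 m - η.1 m‖ ^ 2 := by
        by_contra hc
        have h0 : ∑ m, ‖θ.1 m - η.1 m‖ ^ 2 = 0 :=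
          le_antisymm (not_lt.1 hc) (Finset.sum_nonneg fun m _ => by positivity)
        rw [Finset.sum_eq_zero_iff_of_nonneg (fun m _ => by positivity)] at h0
        apply hne
        apply Subtype.ext
        funext m
        have := h0 m (Finset.mem_univ _)
        rw [sq_eq_zero_iff, norm_eq_zero, sub_eq_zero] at this
        exact this.symm
      simp only [kap_eq, sub_self]
      simp
      linarith)
    (fun η _ => kap_nonneg θ η) (by rw [kap_eq]; simp [hk]) (Set.mem_univ _)
    (integrable_of_cont hF).integrableOn hF.continuousWithinAt
  simp only [Measure.restrict_univ, smul_eq_mul] at key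
  refine key.congr fun n => ?_
  simp only [avg, ZK, mul_comm]

/-- The approximation. -/
lemma approx_exists {d k : ℕ} (m0 : Fin k) {μ : Measure (Stiefel d k)} (hμ : IsHaarStiefel μ)
    {F : Stiefel d k → ℝ} (hF : Continuous F) (L M : ℝ) (hL0 : 0 ≤ L)
    (hM : ∀ θ, |F θ| ≤ M)
    (hL : ∀ θ θ', |F θ - F θ'| ≤ L * stiefelDist θ θ')
    (hflip : ∀ θ, F (flipS m0 θ) = F θ) :
    ∃ f : ℕ → MPoly d k, (∀ n, f n ∈ VS d m0 n) ∧
      (∀ n θ, √(ev (gam (f n) (f n)) θ) ≤ 2 * L) ∧ (∀ n θ, |ev (f n) θ| ≤ M) ∧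
      ∀ θ, Filter.Tendsto (fun n => ev (f n) θ) Filter.atTop (nhds (F θ)) := by
  have := hμ.1
  have hne : Nonempty (Stiefel d k) := by
    by_contra h
    rw [not_nonempty_iff] at h
    have h1 : μ Set.univ = 1 := measure_univ
    rw [Set.univ_eq_empty_iff.2 h] at h1
    simp at h1
  obtain ⟨θ0⟩ := hne
  have hM0 : 0 ≤ M := (abs_nonneg _).trans (hM θ0)
  have hex : ∀ n, ∃ p ∈ VS d m0 n, ∀ θ, ev p θ = (avg μ n F θ + avg μ n F (flipS m0 θ)) / 2 := by
    intro n
    obtain ⟨p, hp, hpe⟩ := poly_integral (μ := μ) (w := cS) continuous_cS n F hF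
    obtain ⟨q, hq, hqe⟩ := poly_integral (μ := μ) (w := fun η => cS (flipS m0 η))
      (continuous_cS.comp (continuous_flipS m0)) n F hF
    have he : ∀ θ, ev (((ZK μ n θ0)⁻¹ / 2) • (p + q)) θ =
        (avg μ n F θ + avg μ n F (flipS m0 θ)) / 2 := by
      intro θ
      have e1 : ev (((ZK μ n θ0)⁻¹ / 2) • (p + q)) θ =
        ((ZK μ n θ0)⁻¹ / 2) * (ev p θ + ev q θ) := by
          simp [ev]
          ring
      rw [e1, avg, avg, ZK_const hμ n θ θ0, ZK_const hμ n (flipS m0 θ) θ0, hpe, hqe]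
      simp only [kap_flip]
      ring
    refine ⟨((ZK μ n θ0)⁻¹ / 2) • (p + q),
      mem_VS.2 ⟨Submodule.smul_mem _ _ (add_mem hp hq), fun θ => ?_⟩, he⟩
    rw [he, he, flipS_flipS, add_comm]
  choose f hf hfe using hex
  have avgM : ∀ n θ, |avg μ n F θ| ≤ M := by
    intro n θ
    have h1 := avg_sub_le (μ := μ) n hF (F' := fun _ => 0) continuous_const M hM0
      (fun η => by simpa using hM η) θ
    simpa [avg] using h1
  refine ⟨f, hf, fun n θ => ?_, fun n θ => ?_, fun θ => ?_⟩
  · refine gam_le_of_lip _ _ L hL0 fun a ha => ?_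
    have hd := ev_lieD_eq_deriv a ha (f n) θ
    refine hd.le_of_lip' (by positivity) (Filter.Eventually.of_forall fun t => ?_)
    have hrot : ∀ η, |avg μ n F (stiefelRotate (flow a ha t) η) - avg μ n F η| ≤
        L * (√(∑ i, ∑ j, a i j ^ 2) * |t|) := by
      intro η
      rw [avg_rotate hμ n hF]
      refine avg_sub_le n (hF.comp (continuous_rotate _)) hF _ (by positivity) (fun ζ => ?_) η
      exact (hL _ _).trans (mul_le_mul_of_nonneg_left (flow_stiefelDist a ha t ζ) hL0)
    rw [rotate_flow_zero, hfe, hfe, flip_rotate, sub_zero, Real.norm_eq_abs, Real.norm_eq_abs]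
    have h1 := abs_le.1 (hrot θ)
    have h2 := abs_le.1 (hrot (flipS m0 θ))
    rw [abs_le]
    constructor <;> linarith
  · rw [hfe]
    have h1 := abs_le.1 (avgM n θ)
    have h2 := abs_le.1 (avgM n (flipS m0 θ))
    rw [abs_le]
    constructor <;> linarith
  · simp only [hfe]
    have h1 := avg_tendsto m0.pos hμ hF θ
    have h2 := avg_tendsto m0.pos hμ hF (flipS m0 θ)
    rw [hflip] at h2
    simpa using (h1.add h2).div_const 2


lemma mgf_lip {d k : ℕ} (hd : 3 ≤ d) (m0 : Fin k) {μ : Measure (Stiefel d k)} (hμ : IsHaarStiefel μ)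
    {F : Stiefel d k → ℝ} (hF : Continuous F) (L : ℝ) (hL0 : 0 ≤ L)
    (hL : ∀ θ θ', |F θ - F θ'| ≤ L * stiefelDist θ θ')
    (hflip : ∀ θ, F (flipS m0 θ) = F θ) (l : ℝ) (hl : 0 ≤ l) :
    ∫ θ, exp (l * (F θ - ∫ η, F η ∂μ)) ∂μ ≤ exp (24 * L ^ 2 * l ^ 2 / d) := by
  have := hμ.1
  obtain ⟨M, hM⟩ := exists_bound_cont hF
  obtain ⟨f, hf, hG, hfM, hlim⟩ := approx_exists m0 hμ hF L M hL0 hM hL hflip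
  have hm : Filter.Tendsto (fun n => ∫ η, ev (f n) η ∂μ) Filter.atTop (nhds (∫ η, F η ∂μ)) :=
    tendsto_integral_of_dominated_convergence (fun _ => M)
      (fun n => (continuous_ev _).aestronglyMeasurable) (integrable_const _)
      (fun n => Filter.Eventually.of_forall fun θ => hfM n θ)
      (Filter.Eventually.of_forall hlim)
  have hmM : ∀ n, |∫ η, ev (f n) η ∂μ| ≤ M := by
    intro n
    have := norm_integral_le_of_norm_le_const (μ := μ) (f := ev (f n)) (C := M)
      (Filter.Eventually.of_forall fun θ => hfM n θ)
    simpa using this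
  have hE : Filter.Tendsto (fun n => ∫ θ, exp (l * (ev (f n) θ - ∫ η, ev (f n) η ∂μ)) ∂μ)
      Filter.atTop (nhds (∫ θ, exp (l * (F θ - ∫ η, F η ∂μ)) ∂μ)) := by
    refine tendsto_integral_of_dominated_convergence (fun _ => exp (l * (2 * M)))
      (fun n => ?_) (integrable_const _)
      (fun n => Filter.Eventually.of_forall fun θ => ?_)
      (Filter.Eventually.of_forall fun θ => ?_)
    · have := continuous_ev (f n)
      exact Continuous.aestronglyMeasurable (by fun_prop)
    · rw [Real.norm_eq_abs, abs_of_pos (exp_pos _)]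
      apply exp_le_exp.2
      apply mul_le_mul_of_nonneg_left _ hl
      have h1 := abs_le.1 (hfM n θ)
      have h2 := abs_le.1 (hmM n)
      linarith
    · exact (((hlim θ).sub hm).const_mul l).rexp
  refine le_of_tendsto hE (Filter.Eventually.of_forall fun n => ?_)
  refine (mgf_poly hd hμ (hf n) (2 * L) (by positivity) (hG n) l hl).trans ?_
  apply exp_le_exp.2
  have hd3 : (3 : ℝ) ≤ d := by exact_mod_cast hd
  have e : l ^ 2 * (2 * L / (((d : ℝ) - 2) / 4) * (2 * L)) / 2 = 8 * (L ^ 2 * l ^ 2) / (d - 2) := by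
    have : (d : ℝ) - 2 ≠ 0 := by linarith
    field_simp
    ring
  rw [e, div_le_div_iff₀ (by linarith) (by linarith)]
  have : 0 ≤ L ^ 2 * l ^ 2 := by positivity
  nlinarith

lemma upper_tail {d k : ℕ} (hd : 3 ≤ d) (m0 : Fin k) {μ : Measure (Stiefel d k)}
    (hμ : IsHaarStiefel μ)
    {F : Stiefel d k → ℝ} (hF : Continuous F) (L : ℝ) (hL0 : 0 < L)
    (hL : ∀ θ θ', |F θ - F θ'| ≤ L * stiefelDist θ θ')
    (hflip : ∀ θ, F (flipS m0 θ) = F θ) (ε : ℝ) (hε : 0 < ε) :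
    μ.real {θ | ε ≤ F θ - ∫ η, F η ∂μ} ≤ exp (-(1 / 96 * d * ε ^ 2 / L ^ 2)) := by
  have := hμ.1
  have hd3 : (3 : ℝ) ≤ d := by exact_mod_cast hd
  have hd0 : (0 : ℝ) < d := by linarith
  have ht : 0 ≤ d * ε / (48 * L ^ 2) := by positivity
  have h1 := measure_ge_le_exp_mul_mgf (μ := μ) (X := fun θ => F θ - ∫ η, F η ∂μ) ε ht
    (integrable_of_cont (by fun_prop))
  refine h1.trans ?_
  refine (mul_le_mul_of_nonneg_left (mgf_lip hd m0 hμ hF L hL0.le hL hflip _ ht)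
    (exp_pos _).le).trans ?_
  rw [← exp_add]
  apply exp_le_exp.2
  apply le_of_eq
  field_simp
  ring

lemma two_tail {d k : ℕ} (hd : 3 ≤ d) (m0 : Fin k) {μ : Measure (Stiefel d k)}
    (hμ : IsHaarStiefel μ)
    {F : Stiefel d k → ℝ} (hF : Continuous F) (L : ℝ) (hL0 : 0 < L)
    (hL : ∀ θ θ', |F θ - F θ'| ≤ L * stiefelDist θ θ')
    (hflip : ∀ θ, F (flipS m0 θ) = F θ) (ε : ℝ) (hε : 0 < ε) :
    μ {θ | |F θ - ∫ η, F η ∂μ| > ε} ≤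
      ENNReal.ofReal (2 * exp (-(1 / 96 * d * ε ^ 2 / L ^ 2))) := by
  have := hμ.1
  have h1 := upper_tail hd m0 hμ hF L hL0 hL hflip ε hε
  have h2 := upper_tail hd m0 hμ (F := fun θ => - F θ) hF.neg L hL0
    (fun θ θ' => by
      have := hL θ θ'
      rwa [neg_sub_neg, abs_sub_comm]) (fun θ => by rw [hflip]) ε hε
  rw [← ofReal_measureReal]
  apply ENNReal.ofReal_le_ofReal
  have hsub : {θ | |F θ - ∫ η, F η ∂μ| > ε} ⊆ {θ | ε ≤ F θ - ∫ η, F η ∂μ} ∪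
      {θ | ε ≤ - F θ - ∫ η, - F η ∂μ} := by
    intro θ hθ
    simp only [Set.mem_ofPred_eq, Set.mem_union, integral_neg] at hθ ⊢
    rcases lt_abs.1 hθ with h | h
    · left; linarith
    · right; linarith
  refine (measureReal_mono hsub).trans ((measureReal_union_le _ _).trans ?_)
  linarith

lemma small_dim {d k : ℕ} (hd : d ≤ 2) (hkd : k ≤ d) {μ : Measure (Stiefel d k)}
    (hμ : IsHaarStiefel μ)
    {F : Stiefel d k → ℝ} (hF : Continuous F) (L : ℝ) (hL0 : 0 < L)
    (hL : ∀ θ θ', |F θ - F θ'| ≤ L * stiefelDist θ θ') (ε : ℝ) (hε : 0 < ε) :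
    μ {θ | |F θ - ∫ η, F η ∂μ| > ε} ≤
      ENNReal.ofReal (2 * exp (-(1 / 96 * d * ε ^ 2 / L ^ 2))) := by
  have := hμ.1
  have hdist : ∀ θ θ' : Stiefel d k, stiefelDist θ θ' ≤ √8 := by
    intro θ θ'
    apply Real.sqrt_le_sqrt
    have : ∀ j, ‖θ.1 j - θ'.1 j‖ ^ 2 ≤ 4 := by
      intro j
      have h := norm_sub_le (θ.1 j) (θ'.1 j)
      rw [θ.2.1 j, θ'.2.1 j] at h
      nlinarith [norm_nonneg (θ.1 j - θ'.1 j)]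
    refine (Finset.sum_le_sum fun j _ => this j).trans ?_
    simp
    have : (k : ℝ) ≤ 2 := by exact_mod_cast hkd.trans hd
    linarith
  have hdev : ∀ θ, |F θ - ∫ η, F η ∂μ| ≤ L * √8 := by
    intro θ
    have e : F θ - ∫ η, F η ∂μ = ∫ η, (F θ - F η) ∂μ := by
      rw [integral_sub (integrable_const _) (integrable_of_cont hF)]
      simp
    rw [e]
    have := norm_integral_le_of_norm_le_const (μ := μ) (f := fun η => F θ - F η) (C := L * √8)
      (Filter.Eventually.of_forall fun η => (hL θ η).trans
        (mul_le_mul_of_nonneg_left (hdist θ η) hL0.le))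
    simpa using this
  by_cases hc : L * √8 ≤ ε
  · have : {θ | |F θ - ∫ η, F η ∂μ| > ε} = ∅ := by
      ext θ
      simpa using (hdev θ).trans hc
    rw [this]; simp
  · push Not at hc
    refine prob_le_one.trans ?_
    rw [← ENNReal.ofReal_one]
    apply ENNReal.ofReal_le_ofReal
    have h8 : ε ^ 2 ≤ 8 * L ^ 2 := by
      have : ε ^ 2 ≤ (L * √8) ^ 2 := by gcongr
      rw [mul_pow, Real.sq_sqrt (by norm_num)] at this
      linarith
    have hd2 : (d : ℝ) ≤ 2 := by exact_mod_cast hd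
    have hb : 1 / 96 * d * ε ^ 2 / L ^ 2 ≤ 1 / 6 := by
      rw [div_le_iff₀ (by positivity)]
      have : (d : ℝ) * ε ^ 2 ≤ 2 * (8 * L ^ 2) := by gcongr
      linarith
    have := Real.add_one_le_exp (-(1 / 96 * d * ε ^ 2 / L ^ 2))
    linarith


/-- coordinate flip -/
def flipE {k : ℕ} (m0 : Fin k) (y : EE k) : EE k := WithLp.toLp 2 fun m => sgn m0 m * y m

lemma flipE_sub {k : ℕ} (m0 : Fin k) (y z : EE k) : ‖flipE m0 y - flipE m0 z‖ = ‖y - z‖ := by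
  rw [EuclideanSpace.norm_eq, EuclideanSpace.norm_eq]
  congr 1
  refine Finset.sum_congr rfl fun m _ => ?_
  simp only [flipE, PiLp.sub_apply, ← mul_sub, norm_mul, mul_pow]
  have : ‖sgn m0 m‖ ^ 2 = 1 := by
    rw [Real.norm_eq_abs, sq_abs, sq, sgn_sq]
  rw [this, one_mul]

lemma flipE_lip {k : ℕ} (m0 : Fin k) : LipschitzWith 1 (flipE m0 : EE k → EE k) :=
  LipschitzWith.of_dist_le_mul fun y z => by
    rw [dist_eq_norm, dist_eq_norm, flipE_sub]; simp

lemma flipE_proj {d k : ℕ} (m0 : Fin k) (θ : Stiefel d k) (x : EE d) :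
    stiefelProj (flipS m0 θ) x = flipE m0 (stiefelProj θ x) := by
  ext m
  simp [stiefelProj, flipE, flipS, real_inner_smul_left]

instance instProbStdG (k : ℕ) : IsProbabilityMeasure (_root_.stdGaussian k) := by
  unfold _root_.stdGaussian
  exact Measure.isProbabilityMeasure_map
    (EuclideanSpace.equiv (Fin k) ℝ).symm.continuous.measurable.aemeasurable

lemma gauss_sgn {k : ℕ} (m0 m : Fin k) :
    MeasurePreserving (fun x : ℝ => sgn m0 m * x) (gaussianReal 0 1) (gaussianReal 0 1) := by
  refine ⟨by fun_prop, ?_⟩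
  rw [gaussianReal_map_const_mul]
  congr 1
  · simp
  · ext
    simp [sq, sgn_sq]

lemma stdG_flip {k : ℕ} (m0 : Fin k) :
    (_root_.stdGaussian k).map (flipE m0) = _root_.stdGaussian k := by
  have h := measurePreserving_pi (fun _ : Fin k => gaussianReal 0 1)
    (fun _ : Fin k => gaussianReal 0 1) (fun m => gauss_sgn m0 m)
  have hm : Measurable ((EuclideanSpace.equiv (Fin k) ℝ).symm : (Fin k → ℝ) → EE k) :=
    (EuclideanSpace.equiv (Fin k) ℝ).symm.continuous.measurable
  unfold _root_.stdGaussian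
  rw [Measure.map_map (flipE_lip m0).continuous.measurable hm]
  conv_rhs => rw [← h.map_eq]
  rw [Measure.map_map hm h.measurable]
  rfl

lemma nu_flip {k : ℕ} (m0 : Fin k) (σ : ℝ) :
    ((_root_.stdGaussian k).map fun z => σ • z).map (flipE m0) =
      (_root_.stdGaussian k).map fun z => σ • z := by
  have hs : Measurable fun z : EE k => σ • z := (continuous_const_smul σ).measurable
  have hf : Measurable (flipE m0 : EE k → EE k) := (flipE_lip m0).continuous.measurable
  rw [Measure.map_map hf hs]
  conv_rhs => rw [← stdG_flip m0, Measure.map_map hs hf]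
  congr 1
  funext z
  ext m
  simp [flipE]
  ring

lemma continuous_proj {d k : ℕ} (θ : Stiefel d k) : Continuous (stiefelProj θ) := by
  unfold stiefelProj
  refine (EuclideanSpace.equiv (Fin k) ℝ).symm.continuous.comp ?_
  exact continuous_pi fun i => continuous_const.inner continuous_id

lemma abs_int_le_one {k : ℕ} (μ : Measure (EE k)) [IsProbabilityMeasure μ] {f : EE k → ℝ}
    (hf : ∀ x, |f x| ≤ 1) : |∫ x, f x ∂μ| ≤ 1 := by
  have := norm_integral_le_of_norm_le_const (μ := μ) (f := f) (C := 1)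
    (Filter.Eventually.of_forall hf)
  simpa using this

lemma dBL_bdd {k : ℕ} (μ ν : Measure (EE k)) [IsProbabilityMeasure μ] [IsProbabilityMeasure ν] :
    BddAbove (Set.range fun f : {f : EE k → ℝ // (∀ x, |f x| ≤ 1) ∧ LipschitzWith 1 f} =>
      |∫ x, f.1 x ∂μ - ∫ x, f.1 x ∂ν|) := by
  refine ⟨2, ?_⟩
  rintro _ ⟨f, rfl⟩
  have h1 := abs_le.1 (abs_int_le_one μ f.2.1)
  have h2 := abs_le.1 (abs_int_le_one ν f.2.1)
  exact abs_le.2 ⟨by linarith, by linarith⟩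

instance instNonemptyBL (k : ℕ) :
    Nonempty {f : EE k → ℝ // (∀ x, |f x| ≤ 1) ∧ LipschitzWith 1 f} :=
  ⟨⟨fun _ => 0, by simp, LipschitzWith.const' 0⟩⟩

lemma dBL_le_add {k : ℕ} (μ μ' ν : Measure (EE k)) [IsProbabilityMeasure μ]
    [IsProbabilityMeasure μ'] [IsProbabilityMeasure ν] (r : ℝ)
    (h : ∀ f : EE k → ℝ, (∀ x, |f x| ≤ 1) → LipschitzWith 1 f →
      |∫ x, f x ∂μ - ∫ x, f x ∂μ'| ≤ r) : dBL μ ν ≤ dBL μ' ν + r := by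
  refine ciSup_le fun f => ?_
  have h1 := le_ciSup (dBL_bdd μ' ν) f
  have h2 := h f.1 f.2.1 f.2.2
  have h3 := abs_sub_le (∫ x, f.1 x ∂μ) (∫ x, f.1 x ∂μ') (∫ x, f.1 x ∂ν)
  have h4 : |∫ x, f.1 x ∂μ' - ∫ x, f.1 x ∂ν| ≤ dBL μ' ν := h1
  linarith

section main
variable {Ω : Type} [MeasurableSpace Ω] {P : Measure Ω} [IsProbabilityMeasure P] {d k : ℕ}
  {X : Ω → EE d}

lemma prob_proj (hX : Measurable X) (θ : Stiefel d k) :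
    IsProbabilityMeasure (P.map fun ω => stiefelProj θ (X ω)) :=
  Measure.isProbabilityMeasure_map ((continuous_proj θ).measurable.comp hX).aemeasurable

lemma prob_nu (k : ℕ) (σ : ℝ) :
    IsProbabilityMeasure ((_root_.stdGaussian k).map fun z => σ • z) :=
  Measure.isProbabilityMeasure_map (continuous_const_smul σ).measurable.aemeasurable

lemma F_flip_le (hX : Measurable X) (σ : ℝ) (m0 : Fin k) (θ : Stiefel d k) :
    dBL (P.map fun ω => stiefelProj (flipS m0 θ) (X ω)) ((_root_.stdGaussian k).map fun z => σ • z)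
     ≤ dBL (P.map fun ω => stiefelProj θ (X ω)) ((_root_.stdGaussian k).map fun z => σ • z) := by
  have p1 := prob_proj (P := P) hX θ
  have p2 := prob_nu k σ
  refine ciSup_le fun f => ?_
  have hfl := (flipE_lip m0).continuous.measurable
  have h := le_ciSup (dBL_bdd (P.map fun ω => stiefelProj θ (X ω))
    ((_root_.stdGaussian k).map fun z => σ • z))
    ⟨fun x => f.1 (flipE m0 x), fun x => f.2.1 _, by
      have := f.2.2.comp (flipE_lip m0)
      rw [one_mul] at this
      exact this⟩
  refine le_trans (le_of_eq ?_) h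
  have hc := f.2.2.continuous
  have e1 : ∫ x, f.1 x ∂((_root_.stdGaussian k).map fun z => σ • z) =
      ∫ x, f.1 (flipE m0 x) ∂((_root_.stdGaussian k).map fun z => σ • z) := by
    conv_lhs => rw [← nu_flip m0 σ]
    rw [integral_map hfl.aemeasurable hc.aestronglyMeasurable]
  have e2 : ∫ x, f.1 x ∂(P.map fun ω => stiefelProj (flipS m0 θ) (X ω)) =
      ∫ x, f.1 (flipE m0 x) ∂(P.map fun ω => stiefelProj θ (X ω)) := by
    have hm : ∀ θ : Stiefel d k, Measurable fun ω => stiefelProj θ (X ω) := fun θ =>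
      (continuous_proj θ).measurable.comp hX
    have hc2 : Continuous fun x => f.1 (flipE m0 x) := hc.comp (flipE_lip m0).continuous
    rw [integral_map (hm _).aemeasurable hc.aestronglyMeasurable,
      integral_map (hm _).aemeasurable hc2.aestronglyMeasurable]
    simp only [flipE_proj]
  rw [e1, e2]

lemma int_inner_sq (hX : Measurable X) (h2 : Integrable (fun ω => ‖X ω‖ ^ 2) P) (v : EE d) :
    Integrable (fun ω => ⟪X ω, v⟫ ^ 2) P := by
  refine Integrable.mono' (h2.mul_const (‖v‖ ^ 2)) ?_ (Filter.Eventually.of_forall fun ω => ?_)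
  · exact ((hX.inner_const (c := v)).pow_const 2).aestronglyMeasurable
  · rw [Real.norm_eq_abs, abs_of_nonneg (sq_nonneg _), ← mul_pow, ← sq_abs]
    gcongr
    exact abs_real_inner_le_norm _ _

lemma inner_sq_le {B : ℝ}
    (hB : IsLUB {r : ℝ | ∃ ξ : EuclideanSpace ℝ (Fin d), ‖ξ‖ = 1 ∧
          r = ∫ ω, ⟪X ω, ξ⟫ ^ 2 ∂P} B) (v : EE d) :
    ∫ ω, ⟪X ω, v⟫ ^ 2 ∂P ≤ B * ‖v‖ ^ 2 := by
  by_cases hv : v = 0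
  · simp [hv]
  have hn : ‖v‖ ≠ 0 := norm_ne_zero_iff.2 hv
  have h := hB.1 ⟨‖v‖⁻¹ • v, by rw [norm_smul, norm_inv, norm_norm, inv_mul_cancel₀ hn], rfl⟩
  simp only [real_inner_smul_right, mul_pow, integral_const_mul] at h
  have hp : 0 < ‖v‖ ^ 2 := by positivity
  rw [inv_pow, inv_mul_le_iff₀ hp] at h
  linarith

lemma B_pos {B σ : ℝ} (hσ : 0 < σ) (hd : 0 < d) (hX : Measurable X)
    (h2 : Integrable (fun ω => ‖X ω‖ ^ 2) P) (hs : ∫ ω, ‖X ω‖ ^ 2 ∂P = σ ^ 2 * d)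
    (hB : IsLUB {r : ℝ | ∃ ξ : EuclideanSpace ℝ (Fin d), ‖ξ‖ = 1 ∧
          r = ∫ ω, ⟪X ω, ξ⟫ ^ 2 ∂P} B) : 0 < B := by
  have e : ∀ ω, ‖X ω‖ ^ 2 = ∑ i, ⟪X ω, EuclideanSpace.basisFun (Fin d) ℝ i⟫ ^ 2 := by
    intro ω
    rw [EuclideanSpace.norm_sq_eq]
    refine Finset.sum_congr rfl fun i _ => ?_
    rw [real_inner_comm, EuclideanSpace.basisFun_inner]
    simp
  simp only [e] at hs
  rw [integral_finsetSum _ fun i _ => int_inner_sq hX h2 _] at hs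
  have h3 : σ ^ 2 * d ≤ ∑ _i : Fin d, B := by
    rw [← hs]
    refine Finset.sum_le_sum fun i _ => ?_
    have := inner_sq_le hB (EuclideanSpace.basisFun (Fin d) ℝ i)
    simpa using this
  simp at h3
  have hd' : (0 : ℝ) < d := by exact_mod_cast hd
  have : 0 < σ ^ 2 * d := by positivity
  by_contra hc
  push Not at hc
  nlinarith

lemma F_lip_le {B : ℝ} (hX : Measurable X)
    (h2 : Integrable (fun ω => ‖X ω‖ ^ 2) P)
    (hB : IsLUB {r : ℝ | ∃ ξ : EuclideanSpace ℝ (Fin d), ‖ξ‖ = 1 ∧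
          r = ∫ ω, ⟪X ω, ξ⟫ ^ 2 ∂P} B) (hB0 : 0 < B) (σ : ℝ) (θ θ' : Stiefel d k) :
    dBL (P.map fun ω => stiefelProj θ (X ω)) ((_root_.stdGaussian k).map fun z => σ • z)
     ≤ dBL (P.map fun ω => stiefelProj θ' (X ω)) ((_root_.stdGaussian k).map fun z => σ • z)
       + √B * stiefelDist θ θ' := by
  have p1 := prob_proj (P := P) hX θ
  have p1' := prob_proj (P := P) hX θ'
  have p2 := prob_nu k σ
  have hm : ∀ θ : Stiefel d k, Measurable fun ω => stiefelProj θ (X ω) := fun θ =>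
    (continuous_proj θ).measurable.comp hX
  refine dBL_le_add _ _ _ _ fun f hf1 hfl => ?_
  let Y : Ω → ℝ := fun ω => ‖stiefelProj θ (X ω) - stiefelProj θ' (X ω)‖
  have hYm : Measurable Y := ((hm θ).sub (hm θ')).norm
  have hY2 : ∀ ω, Y ω ^ 2 = ∑ j, ⟪X ω, θ.1 j - θ'.1 j⟫ ^ 2 := by
    intro ω
    simp only [Y]
    rw [EuclideanSpace.norm_sq_eq]
    refine Finset.sum_congr rfl fun j _ => ?_
    rw [inner_sub_right, real_inner_comm, real_inner_comm (θ'.1 j)]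
    simp [stiefelProj]
  have hYi : Integrable (fun ω => Y ω ^ 2) P := by
    simp only [hY2]
    exact integrable_finsetSum _ fun j _ => int_inner_sq hX h2 _
  have hmem : MemLp Y 2 P := (memLp_two_iff_integrable_sq hYm.aestronglyMeasurable).2 hYi
  have hYint : Integrable Y P := hmem.integrable (by norm_num)
  have hEY2 : ∫ ω, Y ω ^ 2 ∂P ≤ B * ∑ j, ‖θ.1 j - θ'.1 j‖ ^ 2 := by
    simp only [hY2]
    rw [integral_finsetSum _ fun i _ => int_inner_sq hX h2 _, Finset.mul_sum]
    exact Finset.sum_le_sum fun j _ => inner_sq_le hB _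
  have hEY : ∫ ω, Y ω ∂P ≤ √B * stiefelDist θ θ' := by
    unfold stiefelDist
    rw [← Real.sqrt_mul hB0.le]
    apply Real.le_sqrt_of_sq_le
    refine le_trans ?_ hEY2
    have hv := variance_nonneg Y P
    rw [variance_eq_sub hmem] at hv
    have : (P[Y ^ 2]) = ∫ ω, Y ω ^ 2 ∂P := rfl
    linarith
  refine le_trans ?_ hEY
  have hfc := hfl.continuous
  rw [integral_map (hm θ).aemeasurable hfc.aestronglyMeasurable,
    integral_map (hm θ').aemeasurable hfc.aestronglyMeasurable]
  have hi : ∀ θ : Stiefel d k, Integrable (fun ω => f (stiefelProj θ (X ω))) P := fun θ =>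
    Integrable.mono' (integrable_const 1) (hfc.measurable.comp (hm θ)).aestronglyMeasurable
      (Filter.Eventually.of_forall fun ω => hf1 _)
  rw [← integral_sub (hi θ) (hi θ'), ← Real.norm_eq_abs]
  refine norm_integral_le_of_norm_le hYint (Filter.Eventually.of_forall fun ω => ?_)
  have := hfl.dist_le_mul (stiefelProj θ (X ω)) (stiefelProj θ' (X ω))
  simpa [dist_eq_norm] using this

end main

lemma stiefelDist_comm' {d k : ℕ} (θ θ' : Stiefel d k) : stiefelDist θ θ' = stiefelDist θ' θ := by
  simp only [stiefelDist, norm_sub_rev]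

lemma continuous_of_lip {d k : ℕ} {F : Stiefel d k → ℝ} (L : ℝ)
    (hL : ∀ θ θ', |F θ - F θ'| ≤ L * stiefelDist θ θ') : Continuous F := by
  rw [continuous_iff_continuousAt]
  intro θ0
  have hv : ∀ j, Continuous fun θ : Stiefel d k => θ.1 j := fun j =>
    (continuous_apply j).comp continuous_subtype_val
  have hc : Continuous fun θ : Stiefel d k => L * stiefelDist θ θ0 := by
    unfold stiefelDist
    refine continuous_const.mul (Continuous.sqrt ?_)
    exact continuous_finsetSum _ fun j _ => (((hv j).sub continuous_const).norm.pow 2)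
  have h0 := hc.tendsto θ0
  have e : stiefelDist θ0 θ0 = 0 := by simp [stiefelDist]
  rw [e, mul_zero] at h0
  exact tendsto_iff_norm_sub_tendsto_zero.2
    (squeeze_zero (fun _ => norm_nonneg _) (fun θ => hL θ θ0) h0)

/-- **Theorem 2 (concX).** Concentration of the conditional bounded-Lipschitz distance
`θ ↦ d_BL(X_θ, σZ)` about its mean: there are absolute constants `C, c > 0` such that
`P_{d,k}[|d_BL(X_θ,σZ) - 𝔼 d_BL(X_θ,σZ)| > ε] ≤ C exp(-cdε²/B)`, where
`B = sup_{ξ ∈ S^{d-1}} 𝔼⟨X,ξ⟩²`. -/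
theorem projections_concX :
    ∃ C c : ℝ, 0 < C ∧ 0 < c ∧
      ∀ {Ω : Type} [MeasurableSpace Ω] (P : Measure Ω), ∀ _ : IsProbabilityMeasure P,
      ∀ (d k : ℕ), 0 < k → k ≤ d →
      ∀ (X : Ω → EuclideanSpace ℝ (Fin d)), Measurable X →
      ∀ σ : ℝ, 0 < σ →
      Integrable (fun ω => ‖X ω‖ ^ 2) P →
      (∫ ω, X ω ∂P) = 0 →
      (∫ ω, ‖X ω‖ ^ 2 ∂P) = σ ^ 2 * d →
      ∀ B : ℝ,
        IsLUB {r : ℝ | ∃ ξ : EuclideanSpace ℝ (Fin d), ‖ξ‖ = 1 ∧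
          r = ∫ ω, ⟪X ω, ξ⟫ ^ 2 ∂P} B →
      ∀ (μ : Measure (Stiefel d k)), IsHaarStiefel μ →
      ∀ ε : ℝ, 0 < ε →
        μ {θ : Stiefel d k |
            |dBL (P.map fun ω => stiefelProj θ (X ω)) ((stdGaussian k).map fun z => σ • z)
              - ∫ θ', dBL (P.map fun ω => stiefelProj θ' (X ω))
                  ((stdGaussian k).map fun z => σ • z) ∂μ| > ε}
          ≤ ENNReal.ofReal (C * Real.exp (-(c * d * ε ^ 2 / B))) := by
  refine ⟨2, 1 / 96, by norm_num, by norm_num, ?_⟩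
  intro Ω _ P hP d k hk hkd X hX σ hσ h2 _ hs B hB μ hμ ε hε
  have hB0 : 0 < B := B_pos hσ (hk.trans_le hkd) hX h2 hs hB
  have hL : ∀ θ θ' : Stiefel d k,
      |dBL (P.map fun ω => stiefelProj θ (X ω)) ((_root_.stdGaussian k).map fun z => σ • z) -
        dBL (P.map fun ω => stiefelProj θ' (X ω)) ((_root_.stdGaussian k).map fun z => σ • z)| ≤
      √B * stiefelDist θ θ' := by
    intro θ θ'
    have h1 := F_lip_le hX h2 hB hB0 σ θ θ'
    have h3 := F_lip_le hX h2 hB hB0 σ θ' θ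
    rw [stiefelDist_comm' θ' θ] at h3
    exact abs_le.2 ⟨by linarith, by linarith⟩
  have hF := continuous_of_lip _ hL
  have hsq : √B ^ 2 = B := Real.sq_sqrt hB0.le
  rcases Nat.lt_or_ge d 3 with hd | hd
  · have := small_dim (by omega) hkd hμ hF (√B) (Real.sqrt_pos.2 hB0) hL ε hε
    rwa [hsq] at this
  · have := two_tail hd ⟨0, hk⟩ hμ hF (√B) (Real.sqrt_pos.2 hB0) hL
      (fun θ => le_antisymm (F_flip_le hX σ _ θ) (by
        have := F_flip_le (P := P) hX σ ⟨0, hk⟩ (flipS ⟨0, hk⟩ θ)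
        rwa [flipS_flipS] at this)) ε hε
    rwa [hsq] at this


end
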